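/- For g = sl_n, so_{2n+1}, so_{2n}, or sp_{2n}, the assignment φ(ω_i^{±1} ⊗ 1) = ω_i^{±1}, φ(e_i ⊗ 1) = e_i, φ(1 ⊗ ω_i'^{±1}) = ω_i'^{±1}, φ(1 ⊗ f_i) = f_i extends to a well-defined isomorphism of Hopf algebras φ : D(B, B') → U_{r,s}(g) from the Drinfel'd double of B(g) and B'(g) onto the two-parameter quantum group U_{r,s}(g). -/

import Mathlib

noncomputable section

/-- The four classical families: A (sl), B (so, odd), C (sp), D (so, even). -/
inductive GT | A | B | C | D
deriving DecidableEq

/-- the rank: n+1 in types A, B, C and n+2 in type D (so that the rank is ≥ 1,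
resp. ≥ 2); in type A of rank N the Lie algebra is sl_{N+1}. -/
def rkOf : GT → ℕ → ℕ
  | .D, n => n+2
  | _,  n => n+1

/-- (ε_j, α_i) for the simple roots of the indicated type of rank N (0-indexed):
α_i = ε_i − ε_{i+1} for the non-final indices (all indices in type A), and
α_{N−1} = ε_{N−1} (B), 2ε_{N−1} (C), ε_{N−2} + ε_{N−1} (D). -/
def ipaG (g : GT) (N : ℕ) (j i : ℕ) : ℤ :=
  if g = .A ∨ i+1 < N then (if j = i then 1 else 0) - (if j = i+1 then 1 else 0)
  else match g with
  | .B => if j+1 = N then 1 else 0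
  | .C => if j+1 = N then 2 else 0
  | _ => if j+2 = N ∨ j+1 = N then 1 else 0

/-- (α_i, α_j) -/
def apaG (g : GT) (N : ℕ) (i j : ℕ) : ℤ :=
  ∑ k ∈ Finset.range (N+1), ipaG g N k i * ipaG g N k j

/-- the Cartan matrix a_{ij} = 2(α_i,α_j)/(α_i,α_i) -/
def aG (g : GT) (N : ℕ) (i j : ℕ) : ℤ := 2 * apaG g N i j / apaG g N i i

/-- d_i, where r_i = r^{d_i}: in type B, r_i = r^{(α_i,α_i)}; otherwise
r_i = r^{(α_i,α_i)/2}. -/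
def dG (g : GT) (N : ℕ) (i : ℕ) : ℤ :=
  if g = .B then apaG g N i i else apaG g N i i / 2

section
variable {K : Type*} [Field K]

/-- r_i (resp. s_i with the other parameter) -/
def riG (g : GT) (N : ℕ) (ρ : K) (i : ℕ) : K := ρ ^ (dG g N i)

/-- The structure constants ⟨ω_i', ω_j⟩ of U_{ρ,σ}(g):
for sl: ρ^{(ε_j,α_i)}σ^{(ε_{j+1},α_i)};
for so odd: ρ^{2(ε_j,α_i)}σ^{2(ε_{j+1},α_i)} (j < N−1), ρ^{2(ε_{N−1},α_i)}
  (i < N−1, j = N−1), ρσ⁻¹ (i = j = N−1);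
for sp: ρ^{(ε_j,α_i)}σ^{(ε_{j+1},α_i)} (j < N−1), ρ^{2(ε_{N−1},α_i)} (i < N−1,
  j = N−1), ρ²σ⁻² (i = j = N−1);
for so even: ρ^{(ε_j,α_i)}σ^{(ε_{j+1},α_i)} (j < N−1), ρ^{(ε_{N−2},α_i)}σ^{−(ε_{N−1},α_i)}
  (i ≠ N−2, j = N−1), ρ^{(ε_{N−1},α_{N−2})}σ^{−(ε_{N−2},α_{N−2})} (i = N−2, j = N−1). -/
def cstG (g : GT) (N : ℕ) (ρ σ : K) (i j : ℕ) : K :=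
  match g with
  | .A => ρ^(ipaG .A N j i) * σ^(ipaG .A N (j+1) i)
  | .B => if j+1 < N then ρ^(2 * ipaG .B N j i) * σ^(2 * ipaG .B N (j+1) i)
          else if i+1 < N then ρ^(2 * ipaG .B N (N-1) i)
          else ρ * σ⁻¹
  | .C => if j+1 < N then ρ^(ipaG .C N j i) * σ^(ipaG .C N (j+1) i)
          else if i+1 < N then ρ^(2 * ipaG .C N (N-1) i)
          else ρ^2 * σ^(-2:ℤ)
  | .D => if j+1 < N then ρ^(ipaG .D N j i) * σ^(ipaG .D N (j+1) i)
          else if i+2 ≠ N then ρ^(ipaG .D N (N-2) i) * σ^(-(ipaG .D N (N-1) i))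
          else ρ^(ipaG .D N (N-1) (N-2)) * σ^(-(ipaG .D N (N-2) (N-2)))

/-- generators e_i, f_i, ω_i^{±1}, ω_i'^{±1} -/
inductive Gen (N : ℕ)
  | e (i : Fin N) | f (i : Fin N)
  | w (i : Fin N) | winv (i : Fin N) | wp (i : Fin N) | wpinv (i : Fin N)

def Gen.toral {N : ℕ} : Gen N → Prop
  | .e _ => False
  | .f _ => False
  | _ => True

variable (K) in
abbrev FG (g : GT) (n : ℕ) : Type _ := FreeAlgebra K (Gen (rkOf g n))

/-- ad_l e_i applied to a word (in the free algebra): ad_l e_i (x) = e_i x − ω_i x ω_i⁻¹ e_i. -/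
def adE {g : GT} {n : ℕ} (i : Fin (rkOf g n)) (x : FG K g n) : FG K g n :=
  FreeAlgebra.ι K (Gen.e i) * x
    - FreeAlgebra.ι K (Gen.w i) * x * FreeAlgebra.ι K (Gen.winv i) * FreeAlgebra.ι K (Gen.e i)

/-- ad_r f_i applied to a word: ad_r f_i (x) = x f_i − f_i ω_i'⁻¹ x ω_i'. -/
def adF {g : GT} {n : ℕ} (i : Fin (rkOf g n)) (x : FG K g n) : FG K g n :=
  x * FreeAlgebra.ι K (Gen.f i)
    - FreeAlgebra.ι K (Gen.f i) * FreeAlgebra.ι K (Gen.wpinv i) * x * FreeAlgebra.ι K (Gen.wp i)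

/-- The defining relations of U_{ρ,σ}(g) in the uniform form of Section 2:
all ω_i^{±1}, ω_j'^{±1} commute and are invertible;
ω_j e_i ω_j⁻¹ = ⟨ω_i',ω_j⟩e_i, ω_j f_i ω_j⁻¹ = ⟨ω_i',ω_j⟩⁻¹f_i,
ω_j' e_i ω_j'⁻¹ = ⟨ω_j',ω_i⟩⁻¹e_i, ω_j' f_i ω_j'⁻¹ = ⟨ω_j',ω_i⟩f_i;
[e_i,f_j] = δ_{ij}(ω_i − ω_i')/(r_i − s_i); and the (r,s)-Serre relations
(ad_l e_i)^{1−a_{ij}}(e_j) = 0, (ad_r f_i)^{1−a_{ij}}(f_j) = 0 for i ≠ j. -/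
inductive RelG (g : GT) (n : ℕ) (ρ σ : K) : FG K g n → FG K g n → Prop
  | comm (x y : Gen (rkOf g n)) (hx : x.toral) (hy : y.toral) :
      RelG g n ρ σ (FreeAlgebra.ι K x * FreeAlgebra.ι K y)
        (FreeAlgebra.ι K y * FreeAlgebra.ι K x)
  | winv_r (i : Fin (rkOf g n)) :
      RelG g n ρ σ (FreeAlgebra.ι K (Gen.w i) * FreeAlgebra.ι K (Gen.winv i)) 1
  | winv_l (i : Fin (rkOf g n)) :
      RelG g n ρ σ (FreeAlgebra.ι K (Gen.winv i) * FreeAlgebra.ι K (Gen.w i)) 1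
  | wpinv_r (i : Fin (rkOf g n)) :
      RelG g n ρ σ (FreeAlgebra.ι K (Gen.wp i) * FreeAlgebra.ι K (Gen.wpinv i)) 1
  | wpinv_l (i : Fin (rkOf g n)) :
      RelG g n ρ σ (FreeAlgebra.ι K (Gen.wpinv i) * FreeAlgebra.ι K (Gen.wp i)) 1
  | wE (i j : Fin (rkOf g n)) :
      RelG g n ρ σ
        (FreeAlgebra.ι K (Gen.w j) * FreeAlgebra.ι K (Gen.e i) * FreeAlgebra.ι K (Gen.winv j))
        (cstG g (rkOf g n) ρ σ i j • FreeAlgebra.ι K (Gen.e i))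
  | wF (i j : Fin (rkOf g n)) :
      RelG g n ρ σ
        (FreeAlgebra.ι K (Gen.w j) * FreeAlgebra.ι K (Gen.f i) * FreeAlgebra.ι K (Gen.winv j))
        ((cstG g (rkOf g n) ρ σ i j)⁻¹ • FreeAlgebra.ι K (Gen.f i))
  | wpE (i j : Fin (rkOf g n)) :
      RelG g n ρ σ
        (FreeAlgebra.ι K (Gen.wp j) * FreeAlgebra.ι K (Gen.e i) * FreeAlgebra.ι K (Gen.wpinv j))
        ((cstG g (rkOf g n) ρ σ j i)⁻¹ • FreeAlgebra.ι K (Gen.e i))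
  | wpF (i j : Fin (rkOf g n)) :
      RelG g n ρ σ
        (FreeAlgebra.ι K (Gen.wp j) * FreeAlgebra.ι K (Gen.f i) * FreeAlgebra.ι K (Gen.wpinv j))
        (cstG g (rkOf g n) ρ σ j i • FreeAlgebra.ι K (Gen.f i))
  | ef (i j : Fin (rkOf g n)) :
      RelG g n ρ σ
        (FreeAlgebra.ι K (Gen.e i) * FreeAlgebra.ι K (Gen.f j)
          - FreeAlgebra.ι K (Gen.f j) * FreeAlgebra.ι K (Gen.e i))
        (if i = j then
          (riG g (rkOf g n) ρ i - riG g (rkOf g n) σ i)⁻¹ •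
            (FreeAlgebra.ι K (Gen.w i) - FreeAlgebra.ι K (Gen.wp i))
        else 0)
  | serreE (i j : Fin (rkOf g n)) (h : i ≠ j) :
      RelG g n ρ σ ((adE i)^[(1 - aG g (rkOf g n) i j).toNat] (FreeAlgebra.ι K (Gen.e j))) 0
  | serreF (i j : Fin (rkOf g n)) (h : i ≠ j) :
      RelG g n ρ σ ((adF i)^[(1 - aG g (rkOf g n) i j).toNat] (FreeAlgebra.ι K (Gen.f j))) 0

variable (K) in
/-- the two-parameter quantum group U_{ρ,σ}(g) -/
abbrev UG (g : GT) (n : ℕ) (ρ σ : K) : Type _ := RingQuot (RelG g n ρ σ)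

/-- images of the generators -/
def genG {g : GT} {n : ℕ} (ρ σ : K) (x : Gen (rkOf g n)) : UG K g n ρ σ :=
  RingQuot.mkAlgHom K (RelG g n ρ σ) (FreeAlgebra.ι K x)



/-!
STATEMENT 7.  For g = sl_n, so_{2n+1}, so_{2n}, or sp_{2n}, the assignment
φ(ω_i^{±1} ⊗ 1) = ω_i^{±1}, φ(e_i ⊗ 1) = e_i, φ(1 ⊗ ω_i'^{±1}) = ω_i'^{±1},
φ(1 ⊗ f_i) = f_i extends to a well-defined isomorphism of Hopf algebras
φ : D(B, B') → U_{r,s}(g) from the Drinfel'd double of B(g) and B'(g) (the K-module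
B ⊗ B' with the tensor-product coalgebra structure and the multiplication (8))
onto the two-parameter quantum group U_{r,s}(g).
-/

open scoped TensorProduct

set_option maxHeartbeats 1000000
set_option synthInstance.maxHeartbeats 1000000

noncomputable section

/-- K = ℚ(r,s) -/
abbrev KK : Type := FractionRing (MvPolynomial (Fin 2) ℚ)
def qr : KK := algebraMap (MvPolynomial (Fin 2) ℚ) KK (MvPolynomial.X 0)
def qs : KK := algebraMap (MvPolynomial (Fin 2) ℚ) KK (MvPolynomial.X 1)

/-- generators e_i, ω_i^{±1} of the Hopf subalgebra B -/
inductive GenE (N : ℕ) | e (i : Fin N) | w (i : Fin N) | winv (i : Fin N)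

/-- generators f_i, ω_i'^{±1} of the Hopf subalgebra B' -/
inductive GenF (N : ℕ) | f (i : Fin N) | wp (i : Fin N) | wpinv (i : Fin N)

def GenE.toral {N : ℕ} : GenE N → Prop
  | .e _ => False
  | _ => True

def GenF.toral {N : ℕ} : GenF N → Prop
  | .f _ => False
  | _ => True

variable (g : GT) (n : ℕ)

abbrev FE : Type := FreeAlgebra KK (GenE (rkOf g n))
abbrev FF : Type := FreeAlgebra KK (GenF (rkOf g n))

/-- ad_l e_i on words in B -/
def adEE (i : Fin (rkOf g n)) (x : FE g n) : FE g n :=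
  FreeAlgebra.ι KK (GenE.e i) * x
    - FreeAlgebra.ι KK (GenE.w i) * x * FreeAlgebra.ι KK (GenE.winv i) * FreeAlgebra.ι KK (GenE.e i)

/-- ad_r f_i on words in B' -/
def adFF (i : Fin (rkOf g n)) (x : FF g n) : FF g n :=
  x * FreeAlgebra.ι KK (GenF.f i)
    - FreeAlgebra.ι KK (GenF.f i) * FreeAlgebra.ι KK (GenF.wpinv i) * x * FreeAlgebra.ι KK (GenF.wp i)

/-- the defining relations of B(g) -/
inductive RelGE : FE g n → FE g n → Prop
  | comm (x y : GenE (rkOf g n)) (hx : x.toral) (hy : y.toral) :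
      RelGE (FreeAlgebra.ι KK x * FreeAlgebra.ι KK y) (FreeAlgebra.ι KK y * FreeAlgebra.ι KK x)
  | winv_r (i : Fin (rkOf g n)) :
      RelGE (FreeAlgebra.ι KK (GenE.w i) * FreeAlgebra.ι KK (GenE.winv i)) 1
  | winv_l (i : Fin (rkOf g n)) :
      RelGE (FreeAlgebra.ι KK (GenE.winv i) * FreeAlgebra.ι KK (GenE.w i)) 1
  | wE (i j : Fin (rkOf g n)) :
      RelGE (FreeAlgebra.ι KK (GenE.w j) * FreeAlgebra.ι KK (GenE.e i) * FreeAlgebra.ι KK (GenE.winv j))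
        (cstG g (rkOf g n) qr qs i j • FreeAlgebra.ι KK (GenE.e i))
  | serreE (i j : Fin (rkOf g n)) (h : i ≠ j) :
      RelGE ((adEE g n i)^[(1 - aG g (rkOf g n) i j).toNat] (FreeAlgebra.ι KK (GenE.e j))) 0

/-- the defining relations of B'(g) -/
inductive RelGF : FF g n → FF g n → Prop
  | comm (x y : GenF (rkOf g n)) (hx : x.toral) (hy : y.toral) :
      RelGF (FreeAlgebra.ι KK x * FreeAlgebra.ι KK y) (FreeAlgebra.ι KK y * FreeAlgebra.ι KK x)
  | wpinv_r (i : Fin (rkOf g n)) :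
      RelGF (FreeAlgebra.ι KK (GenF.wp i) * FreeAlgebra.ι KK (GenF.wpinv i)) 1
  | wpinv_l (i : Fin (rkOf g n)) :
      RelGF (FreeAlgebra.ι KK (GenF.wpinv i) * FreeAlgebra.ι KK (GenF.wp i)) 1
  | wpF (i j : Fin (rkOf g n)) :
      RelGF (FreeAlgebra.ι KK (GenF.wp j) * FreeAlgebra.ι KK (GenF.f i) * FreeAlgebra.ι KK (GenF.wpinv j))
        (cstG g (rkOf g n) qr qs j i • FreeAlgebra.ι KK (GenF.f i))
  | serreF (i j : Fin (rkOf g n)) (h : i ≠ j) :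
      RelGF ((adFF g n i)^[(1 - aG g (rkOf g n) i j).toNat] (FreeAlgebra.ι KK (GenF.f j))) 0

/-- the Hopf subalgebra B (upper part) -/
abbrev BB : Type := RingQuot (RelGE g n)
/-- the Hopf subalgebra B' (lower part) -/
abbrev BB' : Type := RingQuot (RelGF g n)

def genE (x : GenE (rkOf g n)) : BB g n := RingQuot.mkAlgHom KK (RelGE g n) (FreeAlgebra.ι KK x)
def genF (x : GenF (rkOf g n)) : BB' g n := RingQuot.mkAlgHom KK (RelGF g n) (FreeAlgebra.ι KK x)

/-- the conditions defining the skew-dual pairing ⟨,⟩ : B' × B → K of Proposition 2.3 -/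
def PairCondG (ΔB : BB g n →ₐ[KK] (BB g n ⊗[KK] BB g n)) (εB : BB g n →ₐ[KK] KK)
    (ΔB' : BB' g n →ₐ[KK] (BB' g n ⊗[KK] BB' g n)) (εB' : BB' g n →ₐ[KK] KK)
    (p : BB' g n →ₗ[KK] BB g n →ₗ[KK] KK) : Prop :=
  (∀ f, p f 1 = εB' f) ∧ (∀ a, p 1 a = εB a) ∧
  (∀ f a a', p f (a * a')
    = LinearMap.mul' KK KK ((TensorProduct.map (p.flip a') (p.flip a)) (ΔB'.toLinearMap f))) ∧
  (∀ f f' a, p (f * f') a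
    = LinearMap.mul' KK KK ((TensorProduct.map (p f) (p f')) (ΔB.toLinearMap a))) ∧
  (∀ i j, p (genF g n (GenF.f i)) (genE g n (GenE.e j))
    = if i = j then (riG g (rkOf g n) qs i - riG g (rkOf g n) qr i)⁻¹ else 0) ∧
  (∀ i j, p (genF g n (GenF.wp i)) (genE g n (GenE.w j)) = cstG g (rkOf g n) qr qs i j) ∧
  (∀ i j, p (genF g n (GenF.wp i)) (genE g n (GenE.winv j)) = (cstG g (rkOf g n) qr qs i j)⁻¹) ∧
  (∀ i j, p (genF g n (GenF.wpinv i)) (genE g n (GenE.w j)) = (cstG g (rkOf g n) qr qs i j)⁻¹) ∧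
  (∀ i j, p (genF g n (GenF.wpinv i)) (genE g n (GenE.winv j)) = cstG g (rkOf g n) qr qs i j) ∧
  (∀ i j, p (genF g n (GenF.f i)) (genE g n (GenE.w j)) = 0) ∧
  (∀ i j, p (genF g n (GenF.f i)) (genE g n (GenE.winv j)) = 0) ∧
  (∀ i j, p (genF g n (GenF.wp i)) (genE g n (GenE.e j)) = 0) ∧
  (∀ i j, p (genF g n (GenF.wpinv i)) (genE g n (GenE.e j)) = 0)

section DoubleDefs

variable (ΔB : BB g n →ₐ[KK] (BB g n ⊗[KK] BB g n))
variable (ΔB' : BB' g n →ₐ[KK] (BB' g n ⊗[KK] BB' g n))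
variable (SB' : BB' g n →ₗ[KK] BB' g n)
variable (p : BB' g n →ₗ[KK] BB g n →ₗ[KK] KK)

/-- Δ² = (Δ ⊗ id) ∘ Δ on B -/
def Del2B : BB g n →ₗ[KK] (BB g n ⊗[KK] BB g n) ⊗[KK] BB g n :=
  (TensorProduct.map ΔB.toLinearMap LinearMap.id) ∘ₗ ΔB.toLinearMap

/-- Δ² on B' -/
def Del2B' : BB' g n →ₗ[KK] (BB' g n ⊗[KK] BB' g n) ⊗[KK] BB' g n :=
  (TensorProduct.map ΔB'.toLinearMap LinearMap.id) ∘ₗ ΔB'.toLinearMap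

/-- f ⊗ a ↦ ⟨S(f), a⟩ -/
def pairS : BB' g n ⊗[KK] BB g n →ₗ[KK] KK := TensorProduct.lift (p ∘ₗ SB')

/-- f ⊗ a ↦ ⟨f, a⟩ -/
def pairP : BB' g n ⊗[KK] BB g n →ₗ[KK] KK := TensorProduct.lift p

/-- the straightening map Ψ : B' ⊗ B → B ⊗ B',
f ⊗ a ↦ Σ ⟨S(f₍₁₎), a₍₁₎⟩⟨f₍₃₎, a₍₃₎⟩ a₍₂₎ ⊗ f₍₂₎, encoding the cross relation (10). -/
def Psi : BB' g n ⊗[KK] BB g n →ₗ[KK] BB g n ⊗[KK] BB' g n :=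
  (TensorProduct.lid KK (BB g n ⊗[KK] BB' g n)).toLinearMap ∘ₗ
  (TensorProduct.rid KK (KK ⊗[KK] (BB g n ⊗[KK] BB' g n))).toLinearMap ∘ₗ
  (TensorProduct.map
    (TensorProduct.map (pairS g n SB' p) (TensorProduct.comm KK (BB' g n) (BB g n)).toLinearMap)
    (pairP g n p)) ∘ₗ
  (TensorProduct.map
    (TensorProduct.tensorTensorTensorComm KK (BB' g n) (BB' g n) (BB g n) (BB g n)).toLinearMap
    LinearMap.id) ∘ₗ
  (TensorProduct.tensorTensorTensorComm KK (BB' g n ⊗[KK] BB' g n) (BB' g n)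
    (BB g n ⊗[KK] BB g n) (BB g n)).toLinearMap ∘ₗ
  (TensorProduct.map (Del2B' g n ΔB') (Del2B g n ΔB))

/-- the multiplication (8) of the Drinfel'd double D(B, B') on the K-module B ⊗ B':
(a ⊗ f)(a' ⊗ f') = Σ ⟨S(f₍₁₎), a'₍₁₎⟩⟨f₍₃₎, a'₍₃₎⟩ a a'₍₂₎ ⊗ f₍₂₎ f'. -/
def doubleMul :
    (BB g n ⊗[KK] BB' g n) ⊗[KK] (BB g n ⊗[KK] BB' g n) →ₗ[KK] BB g n ⊗[KK] BB' g n :=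
  (TensorProduct.map (LinearMap.mul' KK (BB g n)) (LinearMap.mul' KK (BB' g n))) ∘ₗ
  (TensorProduct.assoc KK (BB g n) (BB g n) (BB' g n ⊗[KK] BB' g n)).symm.toLinearMap ∘ₗ
  (TensorProduct.map LinearMap.id
    (TensorProduct.assoc KK (BB g n) (BB' g n) (BB' g n)).toLinearMap) ∘ₗ
  (TensorProduct.map LinearMap.id
    (TensorProduct.map (Psi g n ΔB ΔB' SB' p) LinearMap.id)) ∘ₗ
  (TensorProduct.map LinearMap.id
    (TensorProduct.assoc KK (BB' g n) (BB g n) (BB' g n)).symm.toLinearMap) ∘ₗ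
  (TensorProduct.assoc KK (BB g n) (BB' g n) (BB g n ⊗[KK] BB' g n)).toLinearMap

/-- the tensor-product coalgebra comultiplication on D(B,B') = B ⊗ B' -/
def doubleComul :
    BB g n ⊗[KK] BB' g n →ₗ[KK] (BB g n ⊗[KK] BB' g n) ⊗[KK] (BB g n ⊗[KK] BB' g n) :=
  (TensorProduct.tensorTensorTensorComm KK (BB g n) (BB g n) (BB' g n) (BB' g n)).toLinearMap ∘ₗ
  (TensorProduct.map ΔB.toLinearMap ΔB'.toLinearMap)

end DoubleDefs

/-- the linear map φ : D(B, B') → U_{r,s}(g), a ⊗ f ↦ a·f (via the canonical maps of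
B and B' into U) -/
def phiMap (jB : BB g n →ₐ[KK] UG KK g n qr qs) (jB' : BB' g n →ₐ[KK] UG KK g n qr qs) :
    BB g n ⊗[KK] BB' g n →ₗ[KK] UG KK g n qr qs :=
  TensorProduct.lift
    (((LinearMap.mul KK (UG KK g n qr qs)).comp jB.toLinearMap).compl₂ jB'.toLinearMap)

section Actions

variable {R A : Type*} [CommRing R] [Ring A] [Algebra R A]

/-- The operator `a ↦ Σ χ(a₍₂₎) a₍₁₎` attached to a functional `χ`. -/
def actR (Δ : A →ₗ[R] A ⊗[R] A) : (A →ₗ[R] R) →ₗ[R] Module.End R A where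
  toFun χ := (TensorProduct.rid R A).toLinearMap ∘ₗ χ.lTensor A ∘ₗ Δ
  map_add' χ ψ := by ext a; simp [LinearMap.lTensor_add]
  map_smul' c χ := by ext a; simp [LinearMap.lTensor_smul]

/-- The operator `a ↦ Σ χ(a₍₁₎) a₍₂₎` attached to a functional `χ`. -/
def actL (Δ : A →ₗ[R] A ⊗[R] A) : (A →ₗ[R] R) →ₗ[R] Module.End R A where
  toFun χ := (TensorProduct.lid R A).toLinearMap ∘ₗ χ.rTensor A ∘ₗ Δ
  map_add' χ ψ := by ext a; simp [LinearMap.rTensor_add]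
  map_smul' c χ := by ext a; simp [LinearMap.rTensor_smul]

theorem actR_apply (Δ : A →ₗ[R] A ⊗[R] A) (χ : A →ₗ[R] R) (a : A) :
    actR Δ χ a = TensorProduct.rid R A (χ.lTensor A (Δ a)) := rfl

theorem actL_apply (Δ : A →ₗ[R] A ⊗[R] A) (χ : A →ₗ[R] R) (a : A) :
    actL Δ χ a = TensorProduct.lid R A (χ.rTensor A (Δ a)) := rfl

/-- Coassociativity of a comultiplication. -/
def Coassoc (Δ : A →ₗ[R] A ⊗[R] A) : Prop :=
  (TensorProduct.assoc R A A A).toLinearMap ∘ₗ Δ.rTensor A ∘ₗ Δ = Δ.lTensor A ∘ₗ Δ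

/-- The convolution product of two functionals. -/
def conv (Δ : A →ₗ[R] A ⊗[R] A) (χ ψ : A →ₗ[R] R) : A →ₗ[R] R :=
  LinearMap.mul' R R ∘ₗ TensorProduct.map χ ψ ∘ₗ Δ

/-- Coassociativity after applying a linear map to the threefold tensor product. -/
theorem Coassoc.contract {Δ : A →ₗ[R] A ⊗[R] A} (h : Coassoc Δ) {M : Type*} [AddCommGroup M]
    [Module R M] (G : A ⊗[R] (A ⊗[R] A) →ₗ[R] M) (a : A) :
    G (TensorProduct.assoc R A A A (Δ.rTensor A (Δ a))) = G (Δ.lTensor A (Δ a)) :=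
  congrArg G (LinearMap.congr_fun h a)

theorem actR_conv {Δ : A →ₗ[R] A ⊗[R] A} (h : Coassoc Δ) (χ ψ : A →ₗ[R] R) :
    actR Δ (conv Δ χ ψ) = actR Δ χ * actR Δ ψ := by
  ext a
  have key := h.contract ((TensorProduct.rid R A).toLinearMap ∘ₗ
    (LinearMap.mul' R R ∘ₗ TensorProduct.map χ ψ).lTensor A) a
  have e1 : ∀ t : A ⊗[R] A, TensorProduct.rid R A ((conv Δ χ ψ).lTensor A t) =
      ((TensorProduct.rid R A).toLinearMap ∘ₗ
        (LinearMap.mul' R R ∘ₗ TensorProduct.map χ ψ).lTensor A) (Δ.lTensor A t) := by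
    intro t
    induction t with
    | zero => simp
    | tmul x y => simp [conv]
    | add x y hx hy => simp only [map_add, hx, hy]
  have e2 : ∀ t : A ⊗[R] A, actR Δ χ (TensorProduct.rid R A (ψ.lTensor A t)) =
      ((TensorProduct.rid R A).toLinearMap ∘ₗ
        (LinearMap.mul' R R ∘ₗ TensorProduct.map χ ψ).lTensor A)
        (TensorProduct.assoc R A A A (Δ.rTensor A t)) := by
    intro t
    induction t with
    | zero => simp
    | tmul x y =>
      simp only [LinearMap.lTensor_tmul, TensorProduct.rid_tmul, map_smul, actR_apply,
        LinearMap.rTensor_tmul]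
      generalize Δ x = s
      induction s with
      | zero => simp
      | tmul u v => simp [smul_smul, mul_comm]
      | add u v hu hv => simp only [map_add, smul_add, hu, hv, TensorProduct.add_tmul]
    | add x y hx hy => simp only [map_add, hx, hy]
  rw [Module.End.mul_apply, actR_apply, e1, actR_apply Δ ψ, e2, key]

theorem actL_conv {Δ : A →ₗ[R] A ⊗[R] A} (h : Coassoc Δ) (χ ψ : A →ₗ[R] R) :
    actL Δ (conv Δ χ ψ) = actL Δ ψ * actL Δ χ := by
  ext a
  have key := h.contract ((TensorProduct.lid R A).toLinearMap ∘ₗ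
    TensorProduct.map χ ((TensorProduct.lid R A).toLinearMap ∘ₗ ψ.rTensor A)) a
  have e1 : ∀ t : A ⊗[R] A, TensorProduct.lid R A ((conv Δ χ ψ).rTensor A t) =
      ((TensorProduct.lid R A).toLinearMap ∘ₗ
        TensorProduct.map χ ((TensorProduct.lid R A).toLinearMap ∘ₗ ψ.rTensor A))
        (TensorProduct.assoc R A A A (Δ.rTensor A t)) := by
    intro t
    induction t with
    | zero => simp
    | tmul x y =>
      simp only [LinearMap.rTensor_tmul, conv, LinearMap.comp_apply]
      generalize Δ x = s
      induction s with
      | zero => simp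
      | tmul u v => simp [smul_smul, mul_comm]
      | add u v hu hv => simp only [map_add, hu, hv, TensorProduct.add_tmul]
    | add x y hx hy => simp only [map_add, hx, hy]
  have e2 : ∀ t : A ⊗[R] A, actL Δ ψ (TensorProduct.lid R A (χ.rTensor A t)) =
      ((TensorProduct.lid R A).toLinearMap ∘ₗ
        TensorProduct.map χ ((TensorProduct.lid R A).toLinearMap ∘ₗ ψ.rTensor A))
        (Δ.lTensor A t) := by
    intro t
    induction t with
    | zero => simp
    | tmul x y => simp [actL_apply]
    | add x y hx hy => simp only [map_add, hx, hy]
  rw [Module.End.mul_apply, actL_apply, e1, actL_apply Δ χ, e2, key]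

theorem commute_actL_actR {Δ : A →ₗ[R] A ⊗[R] A} (h : Coassoc Δ) (χ ψ : A →ₗ[R] R) :
    Commute (actL Δ χ) (actR Δ ψ) := by
  ext a
  have key := h.contract ((TensorProduct.lid R A).toLinearMap ∘ₗ
    TensorProduct.map χ ((TensorProduct.rid R A).toLinearMap ∘ₗ ψ.lTensor A)) a
  have e1 : ∀ t : A ⊗[R] A, actL Δ χ (TensorProduct.rid R A (ψ.lTensor A t)) =
      ((TensorProduct.lid R A).toLinearMap ∘ₗ
        TensorProduct.map χ ((TensorProduct.rid R A).toLinearMap ∘ₗ ψ.lTensor A))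
        (TensorProduct.assoc R A A A (Δ.rTensor A t)) := by
    intro t
    induction t with
    | zero => simp
    | tmul x y =>
      simp only [LinearMap.lTensor_tmul, TensorProduct.rid_tmul, map_smul, actL_apply,
        LinearMap.rTensor_tmul]
      generalize Δ x = s
      induction s with
      | zero => simp
      | tmul u v => simp [smul_smul, mul_comm]
      | add u v hu hv => simp only [map_add, smul_add, hu, hv, TensorProduct.add_tmul]
    | add x y hx hy => simp only [map_add, hx, hy]
  have e2 : ∀ t : A ⊗[R] A, actR Δ ψ (TensorProduct.lid R A (χ.rTensor A t)) =
      ((TensorProduct.lid R A).toLinearMap ∘ₗ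
        TensorProduct.map χ ((TensorProduct.rid R A).toLinearMap ∘ₗ ψ.lTensor A))
        (Δ.lTensor A t) := by
    intro t
    induction t with
    | zero => simp
    | tmul x y => simp [actR_apply]
    | add x y hx hy => simp only [map_add, hx, hy]
  rw [Module.End.mul_apply, Module.End.mul_apply, actR_apply, e1, actL_apply, e2, key]

theorem actR_mul (Δ : A →ₐ[R] A ⊗[R] A) {χ χ₁ χ₂ χ₃ χ₄ : A →ₗ[R] R}
    (h : ∀ a b, χ (a * b) = χ₁ a * χ₂ b + χ₃ a * χ₄ b) (a b : A) :
    actR Δ.toLinearMap χ (a * b) = actR Δ.toLinearMap χ₁ a * actR Δ.toLinearMap χ₂ b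
      + actR Δ.toLinearMap χ₃ a * actR Δ.toLinearMap χ₄ b := by
  simp only [actR_apply, AlgHom.toLinearMap_apply, map_mul]
  generalize Δ a = s
  generalize Δ b = t
  induction s with
  | zero => simp
  | add u v hu hv => simp only [map_add, add_mul, hu, hv]; abel
  | tmul u v =>
    induction t with
    | zero => simp
    | add u v hu hv => simp only [map_add, mul_add, hu, hv]; abel
    | tmul x y => simp [h, smul_smul, add_smul, mul_comm]

theorem actL_mul (Δ : A →ₐ[R] A ⊗[R] A) {χ χ₁ χ₂ χ₃ χ₄ : A →ₗ[R] R}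
    (h : ∀ a b, χ (a * b) = χ₁ a * χ₂ b + χ₃ a * χ₄ b) (a b : A) :
    actL Δ.toLinearMap χ (a * b) = actL Δ.toLinearMap χ₁ a * actL Δ.toLinearMap χ₂ b
      + actL Δ.toLinearMap χ₃ a * actL Δ.toLinearMap χ₄ b := by
  simp only [actL_apply, AlgHom.toLinearMap_apply, map_mul]
  generalize Δ a = s
  generalize Δ b = t
  induction s with
  | zero => simp
  | add u v hu hv => simp only [map_add, add_mul, hu, hv]; abel
  | tmul u v =>
    induction t with
    | zero => simp
    | add u v hu hv => simp only [map_add, mul_add, hu, hv]; abel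
    | tmul x y => simp [h, smul_smul, add_smul, mul_comm]

end Actions

section SkewPairing

variable {R A A' : Type*} [CommRing R] [Ring A] [Algebra R A] [Ring A'] [Algebra R A']

/-- A skew pairing between `A'` and `A`, where the bialgebra `A` is counital and coassociative and
`S` is an antiendomorphism of `A'`. -/
structure SkewPairing (Δ : A →ₐ[R] A ⊗[R] A) (ε : A →ₐ[R] R) (Δ' : A' →ₐ[R] A' ⊗[R] A')
    (ε' : A' →ₐ[R] R) (S : A' →ₗ[R] A') (p : A' →ₗ[R] A →ₗ[R] R) : Prop where
  coassoc : Coassoc Δ.toLinearMap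
  actR_counit : actR Δ.toLinearMap ε.toLinearMap = 1
  actL_counit : actL Δ.toLinearMap ε.toLinearMap = 1
  antipode_one : S 1 = 1
  antipode_mul : ∀ x y, S (x * y) = S y * S x
  pair_one : ∀ f, p f 1 = ε' f
  one_pair : ∀ a, p 1 a = ε a
  pair_mul : ∀ f a b, p f (a * b) =
    LinearMap.mul' R R (TensorProduct.map (p.flip b) (p.flip a) (Δ' f))
  mul_pair : ∀ f g a, p (f * g) a = LinearMap.mul' R R (TensorProduct.map (p f) (p g) (Δ a))

variable {Δ : A →ₐ[R] A ⊗[R] A} {ε : A →ₐ[R] R} {Δ' : A' →ₐ[R] A' ⊗[R] A'}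
    {ε' : A' →ₐ[R] R} {S : A' →ₗ[R] A'} {p : A' →ₗ[R] A →ₗ[R] R}

namespace SkewPairing

theorem one_pair' (h : SkewPairing Δ ε Δ' ε' S p) : p 1 = ε.toLinearMap :=
  LinearMap.ext h.one_pair

theorem mul_pair' (h : SkewPairing Δ ε Δ' ε' S p) (f g : A') :
    p (f * g) = conv Δ.toLinearMap (p f) (p g) :=
  LinearMap.ext (h.mul_pair f g)

/-- The action `f ⇀ a = Σ ⟨f, a₍₂₎⟩ a₍₁₎` of `A'` on `A`. -/
def rightOp (h : SkewPairing Δ ε Δ' ε' S p) : A' →ₐ[R] Module.End R A :=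
  AlgHom.ofLinearMap (actR Δ.toLinearMap ∘ₗ p)
    (by rw [LinearMap.comp_apply, h.one_pair', h.actR_counit])
    (fun f g => by simp only [LinearMap.comp_apply, h.mul_pair', actR_conv h.coassoc])

/-- The action `a ↦ Σ ⟨S(f), a₍₁₎⟩ a₍₂₎` of `A'` on `A`. -/
def leftOp (h : SkewPairing Δ ε Δ' ε' S p) : A' →ₐ[R] Module.End R A :=
  AlgHom.ofLinearMap (actL Δ.toLinearMap ∘ₗ p ∘ₗ S)
    (by rw [LinearMap.comp_apply, LinearMap.comp_apply, h.antipode_one, h.one_pair', h.actL_counit])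
    (fun f g => by
      simp only [LinearMap.comp_apply, h.antipode_mul, h.mul_pair', actL_conv h.coassoc])

theorem rightOp_eq (h : SkewPairing Δ ε Δ' ε' S p) (f : A') :
    h.rightOp f = actR Δ.toLinearMap (p f) := rfl

theorem leftOp_eq (h : SkewPairing Δ ε Δ' ε' S p) (f : A') :
    h.leftOp f = actL Δ.toLinearMap (p (S f)) := rfl

theorem commute_leftOp_rightOp (h : SkewPairing Δ ε Δ' ε' S p) (f g : A') :
    Commute (h.leftOp f) (h.rightOp g) :=
  commute_actL_actR h.coassoc _ _

/-- The product of `h.leftOp` and `h.rightOp` with the middle factor untouched: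
`f ⊗ g ⊗ k ↦ (leftOp f ∘ rightOp k) ⊗ g`. -/
def tripleOp (h : SkewPairing Δ ε Δ' ε' S p) :
    (A' ⊗[R] A') ⊗[R] A' →ₐ[R] Module.End R A ⊗[R] A' :=
  Algebra.TensorProduct.lift (Algebra.TensorProduct.map h.leftOp (AlgHom.id R A'))
    (Algebra.TensorProduct.includeLeft.comp h.rightOp) (fun t k => by
      induction t with
      | zero => simp
      | add x y hx hy => rw [map_add]; exact hx.add_left hy
      | tmul f g =>
        simp only [Algebra.TensorProduct.map_tmul, AlgHom.comp_apply,
          Algebra.TensorProduct.includeLeft_apply, AlgHom.id_apply]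
        exact (h.commute_leftOp_rightOp f k).tmul (Commute.one_right g))

theorem tripleOp_tmul (h : SkewPairing Δ ε Δ' ε' S p) (f g k : A') :
    h.tripleOp ((f ⊗ₜ g) ⊗ₜ k) = (h.leftOp f * h.rightOp k) ⊗ₜ g := by
  simp [tripleOp]

/-- The algebra map `f ↦ Σ (leftOp f₍₁₎ ∘ rightOp f₍₃₎) ⊗ f₍₂₎` describing how `f` is moved past
elements of `A` in the double. -/
def straighten (h : SkewPairing Δ ε Δ' ε' S p) : A' →ₐ[R] Module.End R A ⊗[R] A' :=
  h.tripleOp.comp ((Algebra.TensorProduct.map Δ' (AlgHom.id R A')).comp Δ')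

theorem straighten_grouplike (h : SkewPairing Δ ε Δ' ε' S p) {k : A'} (hk : Δ' k = k ⊗ₜ k) :
    h.straighten k = (h.leftOp k * h.rightOp k) ⊗ₜ k := by
  simp [straighten, hk, tripleOp_tmul]

theorem straighten_skewPrimitive (h : SkewPairing Δ ε Δ' ε' S p) {f k : A'}
    (hf : Δ' f = 1 ⊗ₜ f + f ⊗ₜ k) :
    h.straighten f =
      h.rightOp f ⊗ₜ 1 + h.rightOp k ⊗ₜ f + (h.leftOp f * h.rightOp k) ⊗ₜ k := by
  simp [straighten, hf, tripleOp_tmul, TensorProduct.add_tmul, add_assoc,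
    Algebra.TensorProduct.one_def]

/-- Left multiplication by `a`, as an element of `End A ⊗ A'`. -/
def leftMul : A →ₐ[R] Module.End R A ⊗[R] A' :=
  Algebra.TensorProduct.includeLeft.comp (Algebra.lmul R A)

theorem leftMul_apply (a : A) : (leftMul a : Module.End R A ⊗[R] A') = Algebra.lmul R A a ⊗ₜ 1 :=
  rfl

theorem grouplike_pair_mul (h : SkewPairing Δ ε Δ' ε' S p) {k : A'} (hk : Δ' k = k ⊗ₜ k) (a b : A) :
    p k (a * b) = p k a * p k b := by
  simp [h.pair_mul, hk, mul_comm]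

theorem skewPrimitive_pair_mul (h : SkewPairing Δ ε Δ' ε' S p) {f k : A'}
    (hf : Δ' f = 1 ⊗ₜ f + f ⊗ₜ k) (a b : A) :
    p f (a * b) = p f a * ε.toLinearMap b + p k a * p f b := by
  simp [h.pair_mul, hf, h.one_pair, mul_comm]

theorem antipode_skewPrimitive_pair_mul (h : SkewPairing Δ ε Δ' ε' S p) {f k k' : A'}
    (hf : Δ' f = 1 ⊗ₜ f + f ⊗ₜ k) (hk' : Δ' k' = k' ⊗ₜ k') (hkk' : k * k' = 1)
    (hS : S f = -(f * k')) (a b : A) :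
    p (S f) (a * b) = p (S f) a * p k' b + ε.toLinearMap a * p (S f) b := by
  simp [h.pair_mul, hS, hf, hk', add_mul, hkk', h.one_pair]
  ring

theorem rightOp_grouplike_mul (h : SkewPairing Δ ε Δ' ε' S p) {k : A'} (hk : Δ' k = k ⊗ₜ k)
    (a b : A) : h.rightOp k (a * b) = h.rightOp k a * h.rightOp k b := by
  simpa [rightOp_eq] using actR_mul Δ (χ := p k) (χ₁ := p k) (χ₂ := p k) (χ₃ := 0) (χ₄ := 0)
    (fun a b => by simp [h.grouplike_pair_mul hk]) a b

theorem leftOp_grouplike_mul (h : SkewPairing Δ ε Δ' ε' S p) {k k' : A'} (hk' : Δ' k' = k' ⊗ₜ k')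
    (hS : S k = k') (a b : A) : h.leftOp k (a * b) = h.leftOp k a * h.leftOp k b := by
  simpa [leftOp_eq, hS] using actL_mul Δ (χ := p k') (χ₁ := p k') (χ₂ := p k') (χ₃ := 0) (χ₄ := 0)
    (fun a b => by simp [h.grouplike_pair_mul hk']) a b

theorem rightOp_skewPrimitive_mul (h : SkewPairing Δ ε Δ' ε' S p) {f k : A'}
    (hf : Δ' f = 1 ⊗ₜ f + f ⊗ₜ k) (a b : A) :
    h.rightOp f (a * b) = h.rightOp f a * b + h.rightOp k a * h.rightOp f b := by
  simpa [rightOp_eq, h.actR_counit] using actR_mul Δ (h.skewPrimitive_pair_mul hf) a b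

theorem leftOp_skewPrimitive_mul (h : SkewPairing Δ ε Δ' ε' S p) {f k k' : A'}
    (hf : Δ' f = 1 ⊗ₜ f + f ⊗ₜ k) (hk' : Δ' k' = k' ⊗ₜ k') (hkk' : k * k' = 1)
    (hS : S f = -(f * k')) (hSk : S k = k') (a b : A) :
    h.leftOp f (a * b) = h.leftOp f a * h.leftOp k b + a * h.leftOp f b := by
  simpa [leftOp_eq, h.actL_counit, hSk] using
    actL_mul Δ (h.antipode_skewPrimitive_pair_mul hf hk' hkk' hS) a b

theorem rightOp_one (h : SkewPairing Δ ε Δ' ε' S p) (f : A') : h.rightOp f 1 = ε' f • 1 := by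
  simp [rightOp_eq, actR_apply, Algebra.TensorProduct.one_def, h.pair_one]

theorem leftOp_one (h : SkewPairing Δ ε Δ' ε' S p) (f : A') : h.leftOp f 1 = ε' (S f) • 1 := by
  simp [leftOp_eq, actL_apply, Algebra.TensorProduct.one_def, h.pair_one]

theorem rightOp_grouplike (h : SkewPairing Δ ε Δ' ε' S p) (f : A') {w : A} (hw : Δ w = w ⊗ₜ w) :
    h.rightOp f w = p f w • w := by
  simp [rightOp_eq, actR_apply, hw]

theorem leftOp_grouplike (h : SkewPairing Δ ε Δ' ε' S p) (f : A') {w : A} (hw : Δ w = w ⊗ₜ w) :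
    h.leftOp f w = p (S f) w • w := by
  simp [leftOp_eq, actL_apply, hw]

theorem rightOp_skewPrimitive (h : SkewPairing Δ ε Δ' ε' S p) (f : A') {e w : A}
    (he : Δ e = e ⊗ₜ 1 + w ⊗ₜ e) : h.rightOp f e = ε' f • e + p f e • w := by
  simp [rightOp_eq, actR_apply, he, h.pair_one]

theorem leftOp_skewPrimitive (h : SkewPairing Δ ε Δ' ε' S p) (f : A') {e w : A}
    (he : Δ e = e ⊗ₜ 1 + w ⊗ₜ e) : h.leftOp f e = p (S f) e • 1 + p (S f) w • e := by
  simp [leftOp_eq, actL_apply, he]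

/-- A grouplike element of `A'` commutes up to a scalar with its eigenvectors in `A`. -/
theorem straighten_grouplike_mul (h : SkewPairing Δ ε Δ' ε' S p) {k k' : A'} (hk : Δ' k = k ⊗ₜ k)
    (hk' : Δ' k' = k' ⊗ₜ k') (hS : S k = k') {x : A} {α β : R}
    (hα : h.rightOp k x = α • x) (hβ : h.leftOp k x = β • x) :
    h.straighten k * leftMul x = (α * β) • (leftMul x * h.straighten k) := by
  rw [h.straighten_grouplike hk, leftMul_apply, Algebra.TensorProduct.tmul_mul_tmul,
    Algebra.TensorProduct.tmul_mul_tmul, one_mul, mul_one, TensorProduct.smul_tmul']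
  congr 1
  ext b
  simp [h.rightOp_grouplike_mul hk, h.leftOp_grouplike_mul hk' hS, hα, hβ, smul_smul]

/-- A skew primitive element of `A'` commutes up to a scalar with grouplike elements of `A`. -/
theorem straighten_skewPrimitive_mul_grouplike (h : SkewPairing Δ ε Δ' ε' S p) {f k k' : A'}
    (hk : Δ' k = k ⊗ₜ k) (hf : Δ' f = 1 ⊗ₜ f + f ⊗ₜ k) (hk' : Δ' k' = k' ⊗ₜ k') (hkk' : k * k' = 1)
    (hS : S f = -(f * k')) (hSk : S k = k') {w : A} (hw : Δ w = w ⊗ₜ w) (hfw : p f w = 0) :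
    h.straighten f * leftMul w = p k w • (leftMul w * h.straighten f) := by
  have hq : p (S f) w = 0 := by simp [hS, h.mul_pair, hw, hfw]
  have e1 : h.rightOp f * Algebra.lmul R A w = p k w • (Algebra.lmul R A w * h.rightOp f) := by
    ext b
    simp [h.rightOp_skewPrimitive_mul hf, h.rightOp_grouplike _ hw, hfw]
  have e2 : h.rightOp k * Algebra.lmul R A w = p k w • (Algebra.lmul R A w * h.rightOp k) := by
    ext b
    simp [h.rightOp_grouplike_mul hk, h.rightOp_grouplike _ hw]
  have e3 : h.leftOp f * Algebra.lmul R A w = Algebra.lmul R A w * h.leftOp f := by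
    ext b
    simp [h.leftOp_skewPrimitive_mul hf hk' hkk' hS hSk, h.leftOp_grouplike _ hw, hq]
  have e4 : h.leftOp f * h.rightOp k * Algebra.lmul R A w =
      p k w • (Algebra.lmul R A w * (h.leftOp f * h.rightOp k)) := by
    rw [mul_assoc, e2, mul_smul_comm, ← mul_assoc, e3, mul_assoc]
  simp only [h.straighten_skewPrimitive hf, leftMul_apply, add_mul, mul_add, smul_add,
    Algebra.TensorProduct.tmul_mul_tmul, one_mul, mul_one, TensorProduct.smul_tmul', e1, e2, e4]

/-- The commutator of skew primitive elements of `A'` and `A` in the double. -/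
theorem straighten_skewPrimitive_mul_skewPrimitive (h : SkewPairing Δ ε Δ' ε' S p) {f k k' : A'}
    (hk : Δ' k = k ⊗ₜ k) (hf : Δ' f = 1 ⊗ₜ f + f ⊗ₜ k) (hk' : Δ' k' = k' ⊗ₜ k') (hkk' : k * k' = 1)
    (hS : S f = -(f * k')) (hSk : S k = k') (hεf : ε' f = 0) (hεk : ε' k = 1) (hεk' : ε' k' = 1)
    {e w : A} (he : Δ e = e ⊗ₜ 1 + w ⊗ₜ e) (hw : Δ w = w ⊗ₜ w) (hfw : p f w = 0)
    (hke : p k e = 0) :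
    h.straighten f * leftMul e =
      leftMul e * h.straighten f + p f e • (leftMul w - h.straighten k) := by
  have hqw : p (S f) w = 0 := by simp [hS, h.mul_pair, hw, hfw]
  have hqe : p (S f) e = - p f e := by simp [hS, h.mul_pair, he, hfw, h.pair_one, hεk']
  have e1 : h.rightOp f * Algebra.lmul R A e =
      p f e • Algebra.lmul R A w + Algebra.lmul R A e * h.rightOp f := by
    ext b
    simp [h.rightOp_skewPrimitive_mul hf, h.rightOp_skewPrimitive _ he, hεf, hεk, hke]
  have e2 : h.rightOp k * Algebra.lmul R A e = Algebra.lmul R A e * h.rightOp k := by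
    ext b
    simp [h.rightOp_grouplike_mul hk, h.rightOp_skewPrimitive _ he, hεk, hke]
  have e3 : h.leftOp f * Algebra.lmul R A e =
      (-p f e) • h.leftOp k + Algebra.lmul R A e * h.leftOp f := by
    ext b
    simp [h.leftOp_skewPrimitive_mul hf hk' hkk' hS hSk, h.leftOp_skewPrimitive _ he, hqw, hqe]
  have e4 : h.leftOp f * h.rightOp k * Algebra.lmul R A e =
      (-p f e) • (h.leftOp k * h.rightOp k) +
        Algebra.lmul R A e * (h.leftOp f * h.rightOp k) := by
    rw [mul_assoc, e2, ← mul_assoc, e3, add_mul, smul_mul_assoc, mul_assoc]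
  simp only [h.straighten_skewPrimitive hf, h.straighten_grouplike hk, leftMul_apply, add_mul,
    mul_add, Algebra.TensorProduct.tmul_mul_tmul, one_mul, mul_one, e1, e2, e4,
    TensorProduct.add_tmul, ← TensorProduct.smul_tmul', smul_sub]
  module

end SkewPairing

/-- The action of `End A ⊗ A'` on `A ⊗ A'`, with `A'` acting by left multiplication. -/
def tensorAct : Module.End R A ⊗[R] A' →ₐ[R] Module.End R (A ⊗[R] A') :=
  Module.endTensorEndAlgHom.comp
    (Algebra.TensorProduct.map (AlgHom.id R (Module.End R A)) (Algebra.lmul R A'))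

@[simp]
theorem tensorAct_tmul_tmul (T : Module.End R A) (f : A') (a : A) (f' : A') :
    tensorAct (T ⊗ₜ[R] f) (a ⊗ₜ[R] f') = T a ⊗ₜ (f * f') := by
  rfl

theorem SkewPairing.tensorAct_straighten_grouplike_one (h : SkewPairing Δ ε Δ' ε' S p) {k : A'}
    (hk : Δ' k = k ⊗ₜ k) (hε : ε' k = 1) (hεS : ε' (S k) = 1) (f' : A') :
    tensorAct (h.straighten k) (1 ⊗ₜ f') = 1 ⊗ₜ (k * f') := by
  simp [h.straighten_grouplike hk, h.rightOp_one, h.leftOp_one, hε, hεS]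

theorem SkewPairing.tensorAct_straighten_skewPrimitive_one (h : SkewPairing Δ ε Δ' ε' S p)
    {f k k' : A'} (hf : Δ' f = 1 ⊗ₜ f + f ⊗ₜ k) (hε : ε' f = 0) (hεk : ε' k = 1)
    (hS : S f = -(f * k')) (f' : A') :
    tensorAct (h.straighten f) (1 ⊗ₜ f') = 1 ⊗ₜ (f * f') := by
  simp [h.straighten_skewPrimitive hf, h.rightOp_one, h.leftOp_one, hε, hS, hεk]

theorem tensorAct_one (d : A ⊗[R] A') : tensorAct (1 : Module.End R A ⊗[R] A') d = d := by
  simp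

variable (R A A') in
/-- The algebra `End A ⊗ A'` acting on `A ⊗ A'`. -/
def OpAlg : Type _ := Module.End R A ⊗[R] A'

instance : Ring (OpAlg R A A') := inferInstanceAs (Ring (Module.End R A ⊗[R] A'))

instance : Algebra R (OpAlg R A A') := inferInstanceAs (Algebra R (Module.End R A ⊗[R] A'))

end SkewPairing
section Presentation

theorem ringQuot_hom_ext {R X B : Type*} [CommRing R] [Semiring B] [Algebra R B]
    {r : FreeAlgebra R X → FreeAlgebra R X → Prop} {φ ψ : RingQuot r →ₐ[R] B}
    (h : ∀ x, φ (RingQuot.mkAlgHom R r (FreeAlgebra.ι R x)) =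
      ψ (RingQuot.mkAlgHom R r (FreeAlgebra.ι R x))) : φ = ψ :=
  RingQuot.ringQuot_ext' R φ ψ (FreeAlgebra.hom_ext (funext h))

theorem ringQuot_induction {R X : Type*} [CommRing R]
    {r : FreeAlgebra R X → FreeAlgebra R X → Prop} {C : RingQuot r → Prop}
    (scalar : ∀ c, C (algebraMap R _ c))
    (gen : ∀ x, C (RingQuot.mkAlgHom R r (FreeAlgebra.ι R x)))
    (mul : ∀ a b, C a → C b → C (a * b)) (add : ∀ a b, C a → C b → C (a + b))
    (a : RingQuot r) : C a := by
  obtain ⟨a, rfl⟩ := RingQuot.mkAlgHom_surjective R r a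
  induction a using FreeAlgebra.induction with
  | grade0 c => simpa using scalar c
  | grade1 x => exact gen x
  | mul a b ha hb => simpa using mul _ _ ha hb
  | add a b ha hb => simpa using add _ _ ha hb

/-- The inclusion of the generators of `B` in those of `U`. -/
def GenE.toGen {N : ℕ} : GenE N → Gen N
  | .e i => .e i
  | .w i => .w i
  | .winv i => .winv i

/-- The inclusion of the generators of `B'` in those of `U`. -/
def GenF.toGen {N : ℕ} : GenF N → Gen N
  | .f i => .f i
  | .wp i => .wp i
  | .wpinv i => .wpinv i

variable {g : GT} {n : ℕ}

theorem BB_hom_ext {B : Type*} [Semiring B] [Algebra KK B] {φ ψ : BB g n →ₐ[KK] B}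
    (h : ∀ x, φ (genE g n x) = ψ (genE g n x)) : φ = ψ :=
  ringQuot_hom_ext h

theorem BB'_hom_ext {B : Type*} [Semiring B] [Algebra KK B] {φ ψ : BB' g n →ₐ[KK] B}
    (h : ∀ x, φ (genF g n x) = ψ (genF g n x)) : φ = ψ :=
  ringQuot_hom_ext h

theorem lift_iterate_adE {W : Type*} [Ring W] [Algebra KK W] (Φ : BB g n →ₐ[KK] W)
    (F : Gen (rkOf g n) → W) (hF : ∀ x : GenE (rkOf g n), F x.toGen = Φ (genE g n x))
    (i j : Fin (rkOf g n)) (m : ℕ) :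
    FreeAlgebra.lift KK F ((adE i)^[m] (FreeAlgebra.ι KK (Gen.e j))) =
      Φ (RingQuot.mkAlgHom KK (RelGE g n)
        ((adEE g n i)^[m] (FreeAlgebra.ι KK (GenE.e j)))) := by
  let κ : FE g n →ₐ[KK] FG KK g n := FreeAlgebra.lift KK (fun x => FreeAlgebra.ι KK x.toGen)
  have hκ : (FreeAlgebra.lift KK F).comp κ = Φ.comp (RingQuot.mkAlgHom KK (RelGE g n)) := by
    ext x
    simpa [κ, genE] using hF x
  have hs : Function.Semiconj κ (adEE g n i) (adE i) := fun x => by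
    simp [κ, adEE, adE, GenE.toGen]
  have he : κ (FreeAlgebra.ι KK (GenE.e j)) = FreeAlgebra.ι KK (Gen.e j) := by
    simp [κ, GenE.toGen]
  rw [← he, ← (hs.iterate_right m).eq]
  exact DFunLike.congr_fun hκ _

theorem lift_iterate_adF {W : Type*} [Ring W] [Algebra KK W] (Φ : BB' g n →ₐ[KK] W)
    (F : Gen (rkOf g n) → W) (hF : ∀ x : GenF (rkOf g n), F x.toGen = Φ (genF g n x))
    (i j : Fin (rkOf g n)) (m : ℕ) :
    FreeAlgebra.lift KK F ((adF i)^[m] (FreeAlgebra.ι KK (Gen.f j))) =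
      Φ (RingQuot.mkAlgHom KK (RelGF g n)
        ((adFF g n i)^[m] (FreeAlgebra.ι KK (GenF.f j)))) := by
  let κ : FF g n →ₐ[KK] FG KK g n := FreeAlgebra.lift KK (fun x => FreeAlgebra.ι KK x.toGen)
  have hκ : (FreeAlgebra.lift KK F).comp κ = Φ.comp (RingQuot.mkAlgHom KK (RelGF g n)) := by
    ext x
    simpa [κ, genF] using hF x
  have hs : Function.Semiconj κ (adFF g n i) (adF i) := fun x => by
    simp [κ, adFF, adF, GenF.toGen]
  have he : κ (FreeAlgebra.ι KK (GenF.f j)) = FreeAlgebra.ι KK (Gen.f j) := by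
    simp [κ, GenF.toGen]
  rw [← he, ← (hs.iterate_right m).eq]
  exact DFunLike.congr_fun hκ _

theorem genE_comm {x y : GenE (rkOf g n)} (hx : x.toral) (hy : y.toral) :
    genE g n x * genE g n y = genE g n y * genE g n x := by
  simpa [genE] using RingQuot.mkAlgHom_rel KK (RelGE.comm (g := g) (n := n) x y hx hy)

theorem genF_comm {x y : GenF (rkOf g n)} (hx : x.toral) (hy : y.toral) :
    genF g n x * genF g n y = genF g n y * genF g n x := by
  simpa [genF] using RingQuot.mkAlgHom_rel KK (RelGF.comm (g := g) (n := n) x y hx hy)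

theorem genE_w_mul_winv (i : Fin (rkOf g n)) :
    genE g n (.w i) * genE g n (.winv i) = 1 := by
  simpa [genE] using RingQuot.mkAlgHom_rel KK (RelGE.winv_r (g := g) (n := n) i)

theorem genE_winv_mul_w (i : Fin (rkOf g n)) :
    genE g n (.winv i) * genE g n (.w i) = 1 := by
  simpa [genE] using RingQuot.mkAlgHom_rel KK (RelGE.winv_l (g := g) (n := n) i)

theorem genF_wp_mul_wpinv (i : Fin (rkOf g n)) :
    genF g n (.wp i) * genF g n (.wpinv i) = 1 := by
  simpa [genF] using RingQuot.mkAlgHom_rel KK (RelGF.wpinv_r (g := g) (n := n) i)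

theorem genF_wpinv_mul_wp (i : Fin (rkOf g n)) :
    genF g n (.wpinv i) * genF g n (.wp i) = 1 := by
  simpa [genF] using RingQuot.mkAlgHom_rel KK (RelGF.wpinv_l (g := g) (n := n) i)

theorem genE_conj (i j : Fin (rkOf g n)) :
    genE g n (.w j) * genE g n (.e i) * genE g n (.winv j) =
      cstG g (rkOf g n) qr qs i j • genE g n (.e i) := by
  simpa [genE] using RingQuot.mkAlgHom_rel KK (RelGE.wE (g := g) (n := n) i j)

theorem genF_conj (i j : Fin (rkOf g n)) :
    genF g n (.wp j) * genF g n (.f i) * genF g n (.wpinv j) =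
      cstG g (rkOf g n) qr qs j i • genF g n (.f i) := by
  simpa [genF] using RingQuot.mkAlgHom_rel KK (RelGF.wpF (g := g) (n := n) i j)

theorem genE_serre {i j : Fin (rkOf g n)} (h : i ≠ j) :
    RingQuot.mkAlgHom KK (RelGE g n)
      ((adEE g n i)^[(1 - aG g (rkOf g n) i j).toNat] (FreeAlgebra.ι KK (GenE.e j))) = 0 := by
  simpa using RingQuot.mkAlgHom_rel KK (RelGE.serreE (g := g) (n := n) i j h)

theorem genF_serre {i j : Fin (rkOf g n)} (h : i ≠ j) :
    RingQuot.mkAlgHom KK (RelGF g n)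
      ((adFF g n i)^[(1 - aG g (rkOf g n) i j).toNat] (FreeAlgebra.ι KK (GenF.f j))) = 0 := by
  simpa using RingQuot.mkAlgHom_rel KK (RelGF.serreF (g := g) (n := n) i j h)

/-- Multiplying out a conjugation relation `u x v = c x` with `v u = 1`. -/
theorem mul_eq_smul_of_conj {W : Type*} [Ring W] [Algebra KK W] {u v x : W} {c : KK}
    (h : u * x * v = c • x) (hvu : v * u = 1) : u * x = c • (x * u) := by
  rw [← smul_mul_assoc, ← h, mul_assoc, hvu, mul_one]

theorem conj_of_mul_eq_smul {W : Type*} [Ring W] [Algebra KK W] {u v x : W} {c : KK}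
    (h : u * x = c • (x * u)) (huv : u * v = 1) : u * x * v = c • x := by
  rw [h, smul_mul_assoc, mul_assoc, huv, mul_one]

theorem inv_mul_eq_smul_of_conj {W : Type*} [Ring W] [Algebra KK W] {u v x : W} {c : KK}
    (h : u * x * v = c • x) (hvu : v * u = 1) (hc : c ≠ 0) : v * x = c⁻¹ • (x * v) := by
  have : x = c⁻¹ • (u * x * v) := by rw [h, inv_smul_smul₀ hc]
  conv_lhs => rw [this, mul_smul_comm, mul_assoc u, ← mul_assoc v, hvu, one_mul]

end Presentation

section Double

variable {g : GT} {n : ℕ}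

/-- The standard Hopf structures of `B` and `B'`, together with the skew pairing. -/
structure StdPairing (ΔB : BB g n →ₐ[KK] (BB g n ⊗[KK] BB g n)) (εB : BB g n →ₐ[KK] KK)
    (ΔB' : BB' g n →ₐ[KK] (BB' g n ⊗[KK] BB' g n)) (εB' : BB' g n →ₐ[KK] KK)
    (SB' : BB' g n →ₗ[KK] BB' g n) (p : BB' g n →ₗ[KK] BB g n →ₗ[KK] KK) : Prop where
  comul_e : ∀ i, ΔB (genE g n (.e i)) =
    genE g n (.e i) ⊗ₜ[KK] 1 + genE g n (.w i) ⊗ₜ[KK] genE g n (.e i)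
  comul_toral : ∀ x : GenE (rkOf g n), x.toral → ΔB (genE g n x) = genE g n x ⊗ₜ[KK] genE g n x
  counit_e : ∀ i, εB (genE g n (.e i)) = 0
  counit_toral : ∀ x : GenE (rkOf g n), x.toral → εB (genE g n x) = 1
  comul_f : ∀ i, ΔB' (genF g n (.f i)) =
    1 ⊗ₜ[KK] genF g n (.f i) + genF g n (.f i) ⊗ₜ[KK] genF g n (.wp i)
  comul_toral' : ∀ x : GenF (rkOf g n), x.toral → ΔB' (genF g n x) = genF g n x ⊗ₜ[KK] genF g n x
  counit_f : ∀ i, εB' (genF g n (.f i)) = 0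
  counit_toral' : ∀ x : GenF (rkOf g n), x.toral → εB' (genF g n x) = 1
  antipode_one : SB' 1 = 1
  antipode_mul : ∀ x y, SB' (x * y) = SB' y * SB' x
  antipode_wp : ∀ i, SB' (genF g n (.wp i)) = genF g n (.wpinv i)
  antipode_wpinv : ∀ i, SB' (genF g n (.wpinv i)) = genF g n (.wp i)
  antipode_f : ∀ i, SB' (genF g n (.f i)) = -(genF g n (.f i) * genF g n (.wpinv i))
  pair : PairCondG g n ΔB εB ΔB' εB' p

namespace StdPairing

variable {ΔB : BB g n →ₐ[KK] (BB g n ⊗[KK] BB g n)} {εB : BB g n →ₐ[KK] KK}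
  {ΔB' : BB' g n →ₐ[KK] (BB' g n ⊗[KK] BB' g n)} {εB' : BB' g n →ₐ[KK] KK}
  {SB' : BB' g n →ₗ[KK] BB' g n} {p : BB' g n →ₗ[KK] BB g n →ₗ[KK] KK}

theorem coassoc (H : StdPairing ΔB εB ΔB' εB' SB' p) :
    Coassoc (R := KK) (A := BB g n) ΔB.toLinearMap := by
  have : (Algebra.TensorProduct.assoc KK KK KK (BB g n) (BB g n) (BB g n)).toAlgHom.comp
      ((Algebra.TensorProduct.map ΔB (AlgHom.id KK (BB g n))).comp ΔB) =
      (Algebra.TensorProduct.map (AlgHom.id KK (BB g n)) ΔB).comp ΔB := by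
    refine BB_hom_ext fun x => ?_
    rcases x with i | i | i
    · have e1 := H.comul_e i
      have e2 := H.comul_toral (.w i) trivial
      simp [e1, e2, TensorProduct.add_tmul, TensorProduct.tmul_add,
        Algebra.TensorProduct.one_def, add_assoc]
    · simp [H.comul_toral (.w i) trivial]
    · simp [H.comul_toral (.winv i) trivial]
  exact LinearMap.ext fun a => DFunLike.congr_fun this a

theorem actR_counit (H : StdPairing ΔB εB ΔB' εB' SB' p) :
    actR (R := KK) (A := BB g n) ΔB.toLinearMap εB.toLinearMap = 1 := by
  have : (Algebra.TensorProduct.rid KK KK (BB g n)).toAlgHom.comp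
      ((Algebra.TensorProduct.map (AlgHom.id KK (BB g n)) εB).comp ΔB) =
      AlgHom.id KK (BB g n) := by
    refine BB_hom_ext fun x => ?_
    rcases x with i | i | i
    · simp [H.comul_e, H.counit_e]
    · simp [H.comul_toral (.w i) trivial, H.counit_toral (.w i) trivial]
    · simp [H.comul_toral (.winv i) trivial, H.counit_toral (.winv i) trivial]
  exact LinearMap.ext fun a => DFunLike.congr_fun this a

theorem actL_counit (H : StdPairing ΔB εB ΔB' εB' SB' p) :
    actL (R := KK) (A := BB g n) ΔB.toLinearMap εB.toLinearMap = 1 := by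
  have : (Algebra.TensorProduct.lid KK (BB g n)).toAlgHom.comp
      ((Algebra.TensorProduct.map εB (AlgHom.id KK (BB g n))).comp ΔB) =
      AlgHom.id KK (BB g n) := by
    refine BB_hom_ext fun x => ?_
    rcases x with i | i | i
    · simp [H.comul_e, H.counit_e, H.counit_toral (.w i) trivial]
    · simp [H.comul_toral (.w i) trivial, H.counit_toral (.w i) trivial]
    · simp [H.comul_toral (.winv i) trivial, H.counit_toral (.winv i) trivial]
  exact LinearMap.ext fun a => DFunLike.congr_fun this a

theorem skewPairing (H : StdPairing ΔB εB ΔB' εB' SB' p) :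
    SkewPairing (R := KK) (A := BB g n) (A' := BB' g n) ΔB εB ΔB' εB' SB' p where
  coassoc := H.coassoc
  actR_counit := H.actR_counit
  actL_counit := H.actL_counit
  antipode_one := H.antipode_one
  antipode_mul := H.antipode_mul
  pair_one := H.pair.1
  one_pair := H.pair.2.1
  pair_mul := H.pair.2.2.1
  mul_pair := H.pair.2.2.2.1

end StdPairing
end Double
section Representation

variable {g : GT} {n : ℕ}
  {ΔB : BB g n →ₐ[KK] (BB g n ⊗[KK] BB g n)} {εB : BB g n →ₐ[KK] KK}
  {ΔB' : BB' g n →ₐ[KK] (BB' g n ⊗[KK] BB' g n)} {εB' : BB' g n →ₐ[KK] KK}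
  {SB' : BB' g n →ₗ[KK] BB' g n} {p : BB' g n →ₗ[KK] BB g n →ₗ[KK] KK}

/-- Left multiplication by `B`, as a map to `End B ⊗ B'`. -/
def leftMulB : BB g n →ₐ[KK] OpAlg KK (BB g n) (BB' g n) :=
  SkewPairing.leftMul (R := KK) (A := BB g n) (A' := BB' g n)

namespace StdPairing

/-- The algebra map describing how elements of `B'` are moved past elements of `B`. -/
def straightenB (H : StdPairing ΔB εB ΔB' εB' SB' p) : BB' g n →ₐ[KK] OpAlg KK (BB g n) (BB' g n) :=
  H.skewPairing.straighten

theorem pair_f_e (H : StdPairing ΔB εB ΔB' εB' SB' p) (i j : Fin (rkOf g n)) :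
    p (genF g n (.f i)) (genE g n (.e j)) =
      if i = j then (riG g (rkOf g n) qs i - riG g (rkOf g n) qr i)⁻¹ else 0 :=
  H.pair.2.2.2.2.1 i j

theorem pair_wp_w (H : StdPairing ΔB εB ΔB' εB' SB' p) (i j : Fin (rkOf g n)) :
    p (genF g n (.wp i)) (genE g n (.w j)) = cstG g (rkOf g n) qr qs i j :=
  H.pair.2.2.2.2.2.1 i j

theorem pair_wpinv_w (H : StdPairing ΔB εB ΔB' εB' SB' p) (i j : Fin (rkOf g n)) :
    p (genF g n (.wpinv i)) (genE g n (.w j)) = (cstG g (rkOf g n) qr qs i j)⁻¹ :=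
  H.pair.2.2.2.2.2.2.2.1 i j

theorem pair_f_w (H : StdPairing ΔB εB ΔB' εB' SB' p) (i j : Fin (rkOf g n)) :
    p (genF g n (.f i)) (genE g n (.w j)) = 0 :=
  H.pair.2.2.2.2.2.2.2.2.2.1 i j

theorem pair_wp_e (H : StdPairing ΔB εB ΔB' εB' SB' p) (i j : Fin (rkOf g n)) :
    p (genF g n (.wp i)) (genE g n (.e j)) = 0 :=
  H.pair.2.2.2.2.2.2.2.2.2.2.2.1 i j

theorem pair_wpinv_e (H : StdPairing ΔB εB ΔB' εB' SB' p) (i j : Fin (rkOf g n)) :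
    p (genF g n (.wpinv i)) (genE g n (.e j)) = 0 :=
  H.pair.2.2.2.2.2.2.2.2.2.2.2.2 i j

theorem pair_wp_mul_pair_wpinv (H : StdPairing ΔB εB ΔB' εB' SB' p) (i : Fin (rkOf g n))
    {x : GenE (rkOf g n)} (hx : x.toral) :
    p (genF g n (.wp i)) (genE g n x) * p (genF g n (.wpinv i)) (genE g n x) = 1 := by
  have h := H.skewPairing.mul_pair (genF g n (.wp i)) (genF g n (.wpinv i)) (genE g n x)
  rw [genF_wp_mul_wpinv, H.skewPairing.one_pair, H.counit_toral x hx, H.comul_toral x hx] at h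
  simpa using h.symm

theorem cstG_ne_zero (H : StdPairing ΔB εB ΔB' εB' SB' p) (i j : Fin (rkOf g n)) :
    cstG g (rkOf g n) qr qs i j ≠ 0 := by
  have h := H.pair_wp_mul_pair_wpinv i (x := .w j) trivial
  rw [H.pair_wp_w] at h
  exact left_ne_zero_of_mul_eq_one h

theorem straighten_commute_leftMul (H : StdPairing ΔB εB ΔB' εB' SB' p) {y : GenF (rkOf g n)}
    (hy : y.toral) {x : GenE (rkOf g n)} (hx : x.toral) :
    Commute (H.straightenB (genF g n y)) (leftMulB (genE g n x)) := by
  have key : ∀ k k' : GenF (rkOf g n), k.toral → k'.toral → SB' (genF g n k) = genF g n k' →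
      p (genF g n k) (genE g n x) * p (genF g n k') (genE g n x) = 1 →
      Commute (H.straightenB (genF g n k)) (leftMulB (genE g n x)) := by
    intro k k' hk hk' hS h1
    have := H.skewPairing.straighten_grouplike_mul (H.comul_toral' k hk) (H.comul_toral' k' hk') hS
      (H.skewPairing.rightOp_grouplike _ (H.comul_toral x hx))
      (H.skewPairing.leftOp_grouplike _ (H.comul_toral x hx))
    rw [hS, h1, one_smul] at this
    exact this
  rcases y with i | i | i
  · exact hy.elim
  · exact key (.wp i) (.wpinv i) trivial trivial (H.antipode_wp i) (H.pair_wp_mul_pair_wpinv i hx)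
  · exact key (.wpinv i) (.wp i) trivial trivial (H.antipode_wpinv i)
      (by rw [mul_comm]; exact H.pair_wp_mul_pair_wpinv i hx)

theorem straighten_wp_mul_e (H : StdPairing ΔB εB ΔB' εB' SB' p) (i j : Fin (rkOf g n)) :
    H.straightenB (genF g n (.wp j)) * leftMulB (genE g n (.e i)) =
      (cstG g (rkOf g n) qr qs j i)⁻¹ • (leftMulB (genE g n (.e i)) *
        H.straightenB (genF g n (.wp j))) := by
  have h1 := H.skewPairing.rightOp_skewPrimitive (genF g n (.wp j)) (H.comul_e i)
  have h2 := H.skewPairing.leftOp_skewPrimitive (genF g n (.wp j)) (H.comul_e i)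
  rw [H.counit_toral' (.wp j) trivial, H.pair_wp_e, zero_smul, add_zero] at h1
  rw [H.antipode_wp, H.pair_wpinv_e, H.pair_wpinv_w, zero_smul, zero_add] at h2
  have := H.skewPairing.straighten_grouplike_mul (H.comul_toral' (.wp j) trivial)
    (H.comul_toral' (.wpinv j) trivial) (H.antipode_wp j) h1 h2
  rw [one_mul] at this
  exact this

theorem straighten_f_mul_w (H : StdPairing ΔB εB ΔB' εB' SB' p) (i j : Fin (rkOf g n)) :
    H.straightenB (genF g n (.f i)) * leftMulB (genE g n (.w j)) =
      cstG g (rkOf g n) qr qs i j • (leftMulB (genE g n (.w j)) *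
        H.straightenB (genF g n (.f i))) := by
  rw [← H.pair_wp_w]
  exact H.skewPairing.straighten_skewPrimitive_mul_grouplike (H.comul_toral' (.wp i) trivial)
    (H.comul_f i) (H.comul_toral' (.wpinv i) trivial) (genF_wp_mul_wpinv i) (H.antipode_f i)
    (H.antipode_wp i) (H.comul_toral (.w j) trivial) (H.pair_f_w i j)

theorem straighten_f_mul_e (H : StdPairing ΔB εB ΔB' εB' SB' p) (i j : Fin (rkOf g n)) :
    H.straightenB (genF g n (.f i)) * leftMulB (genE g n (.e j)) =
      leftMulB (genE g n (.e j)) * H.straightenB (genF g n (.f i)) +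
      p (genF g n (.f i)) (genE g n (.e j)) • (leftMulB (genE g n (.w j)) -
        H.straightenB (genF g n (.wp i))) :=
  H.skewPairing.straighten_skewPrimitive_mul_skewPrimitive (H.comul_toral' (.wp i) trivial)
    (H.comul_f i) (H.comul_toral' (.wpinv i) trivial) (genF_wp_mul_wpinv i) (H.antipode_f i)
    (H.antipode_wp i) (H.counit_f i) (H.counit_toral' (.wp i) trivial)
    (H.counit_toral' (.wpinv i) trivial) (H.comul_e j) (H.comul_toral (.w j) trivial)
    (H.pair_f_w i j) (H.pair_wp_e i j)

/-- The images of the generators of `U` in `End B ⊗ B'`. -/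
def repGen (H : StdPairing ΔB εB ΔB' εB' SB' p) :
    Gen (rkOf g n) → OpAlg KK (BB g n) (BB' g n)
  | .e i => leftMulB (genE g n (.e i))
  | .w i => leftMulB (genE g n (.w i))
  | .winv i => leftMulB (genE g n (.winv i))
  | .f i => H.straightenB (genF g n (.f i))
  | .wp i => H.straightenB (genF g n (.wp i))
  | .wpinv i => H.straightenB (genF g n (.wpinv i))

theorem repGen_toGen (H : StdPairing ΔB εB ΔB' εB' SB' p) (x : GenE (rkOf g n)) :
    H.repGen x.toGen = leftMulB (genE g n x) := by
  cases x <;> rfl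

theorem repGen_toGen' (H : StdPairing ΔB εB ΔB' εB' SB' p) (y : GenF (rkOf g n)) :
    H.repGen y.toGen = H.straightenB (genF g n y) := by
  cases y <;> rfl

theorem repGen_commute (H : StdPairing ΔB εB ΔB' εB' SB' p) {x y : Gen (rkOf g n)}
    (hx : x.toral) (hy : y.toral) : Commute (H.repGen x) (H.repGen y) := by
  have hxs : ∀ z : Gen (rkOf g n), z.toral → (∃ u : GenE (rkOf g n), u.toral ∧ z = u.toGen) ∨
      ∃ u : GenF (rkOf g n), u.toral ∧ z = u.toGen := by
    rintro (i | i | i | i | i | i) hz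
    · exact hz.elim
    · exact hz.elim
    · exact .inl ⟨.w i, trivial, rfl⟩
    · exact .inl ⟨.winv i, trivial, rfl⟩
    · exact .inr ⟨.wp i, trivial, rfl⟩
    · exact .inr ⟨.wpinv i, trivial, rfl⟩
  rcases hxs x hx with ⟨u, hu, rfl⟩ | ⟨u, hu, rfl⟩ <;>
    rcases hxs y hy with ⟨v, hv, rfl⟩ | ⟨v, hv, rfl⟩ <;>
    simp only [repGen_toGen, repGen_toGen']
  · exact Commute.map (genE_comm hu hv) leftMulB
  · exact (H.straighten_commute_leftMul hv hu).symm
  · exact H.straighten_commute_leftMul hu hv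
  · exact Commute.map (genF_comm hu hv) H.straightenB

theorem lift_repGen_rel (H : StdPairing ΔB εB ΔB' εB' SB' p) ⦃a b : FG KK g n⦄
    (hab : RelG g n qr qs a b) :
    FreeAlgebra.lift KK H.repGen a = FreeAlgebra.lift KK H.repGen b := by
  have hw : ∀ i : Fin (rkOf g n), leftMulB (genE g n (.w i)) * leftMulB (genE g n (.winv i)) = 1 :=
    fun i => by rw [← map_mul, genE_w_mul_winv, map_one]
  have hwp : ∀ i : Fin (rkOf g n), H.straightenB (genF g n (.wp i)) *
      H.straightenB (genF g n (.wpinv i)) = 1 :=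
    fun i => by rw [← map_mul, genF_wp_mul_wpinv, map_one]
  cases hab with
  | comm x y hx hy => simpa using (H.repGen_commute hx hy).eq
  | winv_r i => simpa [repGen] using hw i
  | winv_l i =>
    simp only [map_mul, map_one, FreeAlgebra.lift_ι_apply, repGen]
    rw [← map_mul, genE_winv_mul_w, map_one]
  | wpinv_r i => simpa [repGen] using hwp i
  | wpinv_l i =>
    simp only [map_mul, map_one, FreeAlgebra.lift_ι_apply, repGen]
    rw [← map_mul, genF_wpinv_mul_wp, map_one]
  | wE i j =>
    simp only [map_mul, map_smul, FreeAlgebra.lift_ι_apply, repGen]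
    rw [← map_mul, ← map_mul, genE_conj, map_smul]
  | wF i j =>
    simp only [map_mul, map_smul, FreeAlgebra.lift_ι_apply, repGen]
    refine conj_of_mul_eq_smul ?_ (hw j)
    rw [H.straighten_f_mul_w, inv_smul_smul₀ (H.cstG_ne_zero i j)]
  | wpE i j =>
    simp only [map_mul, map_smul, FreeAlgebra.lift_ι_apply, repGen]
    exact conj_of_mul_eq_smul (H.straighten_wp_mul_e i j) (hwp j)
  | wpF i j =>
    simp only [map_mul, map_smul, FreeAlgebra.lift_ι_apply, repGen]
    rw [← map_mul, ← map_mul, genF_conj, map_smul]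
  | ef i j =>
    simp only [map_sub, map_mul, FreeAlgebra.lift_ι_apply, repGen, H.straighten_f_mul_e j i,
      H.pair_f_e]
    by_cases hij : i = j
    · subst hij
      simp only [if_true, map_smul, map_sub, FreeAlgebra.lift_ι_apply, repGen]
      rw [← neg_sub (riG g (rkOf g n) qr i), inv_neg, neg_smul]
      abel
    · simp [hij, Ne.symm hij]
  | serreE i j hij =>
    rw [lift_iterate_adE leftMulB _ H.repGen_toGen, genE_serre hij, map_zero, map_zero]
  | serreF i j hij =>
    rw [lift_iterate_adF H.straightenB _ H.repGen_toGen', genF_serre hij, map_zero,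
      map_zero]

/-- The representation of `U` in `End B ⊗ B'` through which `U` acts on the double. -/
def rep (H : StdPairing ΔB εB ΔB' εB' SB' p) :
    UG KK g n qr qs →ₐ[KK] OpAlg KK (BB g n) (BB' g n) :=
  RingQuot.liftAlgHom KK ⟨FreeAlgebra.lift KK H.repGen, H.lift_repGen_rel⟩

theorem rep_genG (H : StdPairing ΔB εB ΔB' εB' SB' p) (x : Gen (rkOf g n)) :
    H.rep (genG qr qs x) = H.repGen x := by
  rw [rep, genG, RingQuot.liftAlgHom_mkAlgHom_apply, FreeAlgebra.lift_ι_apply]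

end StdPairing

end Representation

section DoubleProduct

variable {R A A' : Type*} [CommRing R] [Ring A] [Algebra R A] [Ring A'] [Algebra R A']

/-- The map `f ⊗ a ↦ Σ ⟨S(f₍₁₎), a₍₁₎⟩⟨f₍₃₎, a₍₃₎⟩ a₍₂₎ ⊗ f₍₂₎`. -/
def crossMap (Δ : A →ₐ[R] A ⊗[R] A) (Δ' : A' →ₐ[R] A' ⊗[R] A') (S : A' →ₗ[R] A')
    (p : A' →ₗ[R] A →ₗ[R] R) : A' ⊗[R] A →ₗ[R] A ⊗[R] A' :=
  (TensorProduct.lid R (A ⊗[R] A')).toLinearMap ∘ₗ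
  (TensorProduct.rid R (R ⊗[R] (A ⊗[R] A'))).toLinearMap ∘ₗ
  (TensorProduct.map
    (TensorProduct.map (TensorProduct.lift (p ∘ₗ S)) (TensorProduct.comm R A' A).toLinearMap)
    (TensorProduct.lift p)) ∘ₗ
  (TensorProduct.map (TensorProduct.tensorTensorTensorComm R A' A' A A).toLinearMap
    LinearMap.id) ∘ₗ
  (TensorProduct.tensorTensorTensorComm R (A' ⊗[R] A') A' (A ⊗[R] A) A).toLinearMap ∘ₗ
  (TensorProduct.map ((TensorProduct.map Δ'.toLinearMap LinearMap.id) ∘ₗ Δ'.toLinearMap)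
    ((TensorProduct.map Δ.toLinearMap LinearMap.id) ∘ₗ Δ.toLinearMap))

/-- The product `(a ⊗ f)(a' ⊗ f') = a Ψ(f ⊗ a') f'` on `A ⊗ A'` attached to a linear map
`Ψ : A' ⊗ A → A ⊗ A'`. -/
def crossMul (Ψ : A' ⊗[R] A →ₗ[R] A ⊗[R] A') :
    (A ⊗[R] A') ⊗[R] (A ⊗[R] A') →ₗ[R] A ⊗[R] A' :=
  (TensorProduct.map (LinearMap.mul' R A) (LinearMap.mul' R A')) ∘ₗ
  (TensorProduct.assoc R A A (A' ⊗[R] A')).symm.toLinearMap ∘ₗ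
  (TensorProduct.map LinearMap.id (TensorProduct.assoc R A A' A').toLinearMap) ∘ₗ
  (TensorProduct.map LinearMap.id (TensorProduct.map Ψ LinearMap.id)) ∘ₗ
  (TensorProduct.map LinearMap.id (TensorProduct.assoc R A' A A').symm.toLinearMap) ∘ₗ
  (TensorProduct.assoc R A A' (A ⊗[R] A')).toLinearMap

theorem tensorAct_leftMul (a b : A) (f : A') :
    tensorAct (SkewPairing.leftMul a) (b ⊗ₜ[R] f) = (a * b) ⊗ₜ f := by
  simp [SkewPairing.leftMul_apply]

theorem crossMul_tmul {Ψ : A' ⊗[R] A →ₗ[R] A ⊗[R] A'} {f : A'} {T : Module.End R A ⊗[R] A'}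
    {a' : A} (h : Ψ (f ⊗ₜ a') = tensorAct T (a' ⊗ₜ 1)) (a : A) (f' : A') :
    crossMul Ψ ((a ⊗ₜ f) ⊗ₜ (a' ⊗ₜ f')) =
      tensorAct (SkewPairing.leftMul a) (tensorAct T (a' ⊗ₜ f')) := by
  have h1 : tensorAct T (a' ⊗ₜ f') =
      LinearMap.lTensor A (LinearMap.mulRight R f') (tensorAct T (a' ⊗ₜ 1)) := by
    clear h
    induction T with
    | zero => simp
    | tmul x y => simp
    | add x y hx hy => simp only [map_add, LinearMap.add_apply, hx, hy]
  rw [h1, ← h]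
  simp only [crossMul, LinearMap.comp_apply, LinearEquiv.coe_coe, TensorProduct.assoc_tmul,
    TensorProduct.map_tmul, LinearMap.id_apply, TensorProduct.assoc_symm_tmul]
  generalize Ψ (f ⊗ₜ a') = z
  induction z with
  | zero => simp
  | tmul x y => simp [tensorAct_leftMul]
  | add x y hx hy => simp only [map_add, TensorProduct.add_tmul, TensorProduct.tmul_add, hx, hy]

namespace SkewPairing

variable {Δ : A →ₐ[R] A ⊗[R] A} {ε : A →ₐ[R] R} {Δ' : A' →ₐ[R] A' ⊗[R] A'}
    {ε' : A' →ₐ[R] R} {S : A' →ₗ[R] A'} {p : A' →ₗ[R] A →ₗ[R] R}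

theorem crossMap_tmul (h : SkewPairing Δ ε Δ' ε' S p) (f : A') (a : A) :
    crossMap Δ Δ' S p (f ⊗ₜ a) = tensorAct (h.straighten f) (a ⊗ₜ 1) := by
  have e : h.straighten f = h.tripleOp (TensorProduct.map Δ'.toLinearMap LinearMap.id (Δ' f)) := rfl
  rw [e]
  simp only [crossMap, LinearMap.comp_apply, LinearEquiv.coe_coe, TensorProduct.map_tmul,
    AlgHom.toLinearMap_apply]
  generalize TensorProduct.map Δ'.toLinearMap LinearMap.id (Δ' f) = t
  induction t with
  | zero => simp
  | add x y hx hy => simp only [map_add, TensorProduct.add_tmul, LinearMap.add_apply, hx, hy]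
  | tmul t f₃ =>
    induction t with
    | zero => simp
    | add x y hx hy => simp only [map_add, TensorProduct.add_tmul, LinearMap.add_apply, hx, hy]
    | tmul f₁ f₂ =>
      simp only [tripleOp_tmul, tensorAct_tmul_tmul, Module.End.mul_apply, rightOp_eq, leftOp_eq,
        mul_one, actR_apply Δ.toLinearMap _ a, AlgHom.toLinearMap_apply]
      generalize Δ a = s
      induction s with
      | zero => simp
      | add x y hx hy => simp only [map_add, TensorProduct.add_tmul, TensorProduct.tmul_add, hx, hy]
      | tmul x y =>
        simp only [TensorProduct.map_tmul, LinearMap.lTensor_tmul, TensorProduct.rid_tmul, map_smul,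
          actL_apply, AlgHom.toLinearMap_apply, LinearMap.id_apply]
        generalize Δ x = s
        induction s with
        | zero => simp
        | add x y hx hy =>
          simp only [map_add, TensorProduct.add_tmul, TensorProduct.tmul_add, smul_add, hx, hy]
        | tmul u v => simp [TensorProduct.smul_tmul', smul_smul]

theorem crossMul_crossMap_tmul (h : SkewPairing Δ ε Δ' ε' S p) (a a' : A) (f f' : A') :
    crossMul (crossMap Δ Δ' S p) ((a ⊗ₜ f) ⊗ₜ (a' ⊗ₜ f')) =
      tensorAct (leftMul a) (tensorAct (h.straighten f) (a' ⊗ₜ f')) :=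
  crossMul_tmul (h.crossMap_tmul f a') a f'

end SkewPairing

end DoubleProduct

section DoubleAction

variable {g : GT} {n : ℕ}
  {ΔB : BB g n →ₐ[KK] (BB g n ⊗[KK] BB g n)} {εB : BB g n →ₐ[KK] KK}
  {ΔB' : BB' g n →ₐ[KK] (BB' g n ⊗[KK] BB' g n)} {εB' : BB' g n →ₐ[KK] KK}
  {SB' : BB' g n →ₗ[KK] BB' g n} {p : BB' g n →ₗ[KK] BB g n →ₗ[KK] KK}

/-- The action of `End B ⊗ B'` on `B ⊗ B'`. -/
def opAct : OpAlg KK (BB g n) (BB' g n) →ₗ[KK]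
    (BB g n ⊗[KK] BB' g n) →ₗ[KK] (BB g n ⊗[KK] BB' g n) :=
  (tensorAct (R := KK) (A := BB g n) (A' := BB' g n)).toLinearMap

theorem opAct_mul (x y : OpAlg KK (BB g n) (BB' g n)) (d : BB g n ⊗[KK] BB' g n) :
    opAct (x * y) d = opAct x (opAct y d) :=
  LinearMap.congr_fun (map_mul (tensorAct (R := KK) (A := BB g n) (A' := BB' g n)) x y) d

theorem opAct_one (d : BB g n ⊗[KK] BB' g n) : opAct 1 d = d :=
  tensorAct_one (R := KK) (A := BB g n) (A' := BB' g n) d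

theorem opAct_leftMulB (a b : BB g n) (f : BB' g n) :
    opAct (leftMulB a) (b ⊗ₜ[KK] f) = (a * b) ⊗ₜ[KK] f :=
  tensorAct_leftMul (R := KK) (A := BB g n) (A' := BB' g n) a b f

namespace StdPairing

theorem doubleMul_tmul (H : StdPairing ΔB εB ΔB' εB' SB' p) (a a' : BB g n) (f f' : BB' g n) :
    doubleMul g n ΔB ΔB' SB' p ((a ⊗ₜ[KK] f) ⊗ₜ[KK] (a' ⊗ₜ[KK] f')) =
      opAct (leftMulB a) (opAct (H.straightenB f) (a' ⊗ₜ[KK] f')) :=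
  H.skewPairing.crossMul_crossMap_tmul a a' f f'

theorem opAct_straightenB_one (H : StdPairing ΔB εB ΔB' εB' SB' p) (f f' : BB' g n) :
    opAct (H.straightenB f) (1 ⊗ₜ[KK] f') = 1 ⊗ₜ[KK] (f * f') := by
  induction f using ringQuot_induction generalizing f' with
  | scalar c =>
    rw [AlgHom.commutes, Algebra.algebraMap_eq_smul_one, Algebra.algebraMap_eq_smul_one, map_smul,
      LinearMap.smul_apply, opAct_one, smul_mul_assoc, one_mul, TensorProduct.tmul_smul]
  | mul f₁ f₂ h₁ h₂ => rw [map_mul, opAct_mul, h₂, h₁, mul_assoc]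
  | add f₁ f₂ h₁ h₂ =>
    rw [map_add, map_add, LinearMap.add_apply, h₁, h₂, add_mul, TensorProduct.tmul_add]
  | gen y =>
    rcases y with i | i | i
    · exact H.skewPairing.tensorAct_straighten_skewPrimitive_one (H.comul_f i) (H.counit_f i)
        (H.counit_toral' (.wp i) trivial) (H.antipode_f i) f'
    · refine H.skewPairing.tensorAct_straighten_grouplike_one (H.comul_toral' (.wp i) trivial)
        (H.counit_toral' (.wp i) trivial) ?_ f'
      rw [H.antipode_wp, H.counit_toral' (.wpinv i) trivial]
    · refine H.skewPairing.tensorAct_straighten_grouplike_one (H.comul_toral' (.wpinv i) trivial)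
        (H.counit_toral' (.wpinv i) trivial) ?_ f'
      rw [H.antipode_wpinv, H.counit_toral' (.wp i) trivial]

end StdPairing

end DoubleAction

section Commutation

variable {g : GT} {n : ℕ}

theorem genG_comm {x y : Gen (rkOf g n)} (hx : x.toral) (hy : y.toral) :
    (genG qr qs x * genG qr qs y : UG KK g n qr qs) = genG qr qs y * genG qr qs x := by
  simpa [genG] using RingQuot.mkAlgHom_rel KK (RelG.comm (ρ := qr) (σ := qs) x y hx hy)

theorem genG_winv_mul_w (i : Fin (rkOf g n)) :
    (genG qr qs (.winv i) * genG qr qs (.w i) : UG KK g n qr qs) = 1 := by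
  simpa [genG] using RingQuot.mkAlgHom_rel KK (RelG.winv_l (ρ := qr) (σ := qs) i)

theorem genG_wpinv_mul_wp (i : Fin (rkOf g n)) :
    (genG qr qs (.wpinv i) * genG qr qs (.wp i) : UG KK g n qr qs) = 1 := by
  simpa [genG] using RingQuot.mkAlgHom_rel KK (RelG.wpinv_l (ρ := qr) (σ := qs) i)

theorem genG_conj_f (i j : Fin (rkOf g n)) :
    (genG qr qs (.w j) * genG qr qs (.f i) * genG qr qs (.winv j) : UG KK g n qr qs) =
      (cstG g (rkOf g n) qr qs i j)⁻¹ • genG qr qs (.f i) := by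
  simpa [genG] using RingQuot.mkAlgHom_rel KK (RelG.wF (ρ := qr) (σ := qs) i j)

theorem genG_conj_e (i j : Fin (rkOf g n)) :
    (genG qr qs (.wp j) * genG qr qs (.e i) * genG qr qs (.wpinv j) : UG KK g n qr qs) =
      (cstG g (rkOf g n) qr qs j i)⁻¹ • genG qr qs (.e i) := by
  simpa [genG] using RingQuot.mkAlgHom_rel KK (RelG.wpE (ρ := qr) (σ := qs) i j)

theorem ringQuot_eq_of_rel_sub {R A : Type*} [CommRing R] [Ring A] [Algebra R A]
    {r : A → A → Prop} {a b c : A} (h : r (a - b) c) :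
    RingQuot.mkAlgHom R r b = RingQuot.mkAlgHom R r a + (-1 : R) • RingQuot.mkAlgHom R r c := by
  have := RingQuot.mkAlgHom_rel R h
  rw [← this, map_sub]
  simp

theorem neg_one_smul_smul_sub {R M : Type*} [CommRing R] [AddCommGroup M] [Module R M]
    (c : R) (x y : M) : (-1 : R) • c • (x - y) = -c • x + c • y := by
  module

theorem genG_f_mul_e (i j : Fin (rkOf g n)) : ∃ c c' : KK,
    (genG qr qs (.f i) * genG qr qs (.e j) : UG KK g n qr qs) =
      genG qr qs (.e j) * genG qr qs (.f i) +
        (c • genG qr qs (.w j) + c' • genG qr qs (.wp j)) := by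
  have h := ringQuot_eq_of_rel_sub (R := KK) (RelG.ef (ρ := qr) (σ := qs) j i)
  split_ifs at h with hij
  · refine ⟨-(riG g (rkOf g n) qr j - riG g (rkOf g n) qs j)⁻¹,
      (riG g (rkOf g n) qr j - riG g (rkOf g n) qs j)⁻¹, ?_⟩
    rw [map_mul, map_mul, map_smul, map_sub] at h
    refine h.trans (congrArg _ ?_)
    exact neg_one_smul_smul_sub _ _ _
  · refine ⟨0, 0, ?_⟩
    simpa [genG] using h

/-- In `U`, generators of `B'` can be moved past generators of `B`. -/
theorem genG_straighten (hc : ∀ i j : Fin (rkOf g n), cstG g (rkOf g n) qr qs i j ≠ 0)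
    (y : GenF (rkOf g n)) (x : GenE (rkOf g n)) : ∃ (k c c' : KK) (i : Fin (rkOf g n)),
    (genG qr qs y.toGen * genG qr qs x.toGen : UG KK g n qr qs) =
      k • (genG qr qs x.toGen * genG qr qs y.toGen) +
        (c • genG qr qs (GenE.w i).toGen + c' • genG qr qs (GenF.wp i).toGen) := by
  have scalar : ∀ (i : Fin (rkOf g n)) (k : KK) (u v : UG KK g n qr qs), u = k • v →
      ∃ (k c c' : KK) (i : Fin (rkOf g n)),
        u = k • v + (c • genG qr qs (GenE.w i).toGen + c' • genG qr qs (GenF.wp i).toGen) :=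
    fun i k u v huv =>
      ⟨k, 0, 0, i, by rw [zero_smul, zero_smul, add_zero, add_zero, huv]⟩
  rcases y with i | i | i <;> rcases x with j | j | j <;> simp only [GenE.toGen, GenF.toGen]
  · obtain ⟨c, c', h⟩ := genG_f_mul_e (g := g) (n := n) i j
    exact ⟨1, c, c', j, by rw [one_smul, h]⟩
  · refine scalar i (cstG g (rkOf g n) qr qs i j) _ _ ?_
    rw [mul_eq_smul_of_conj (genG_conj_f i j) (genG_winv_mul_w j), smul_inv_smul₀ (hc i j)]
  · refine scalar i (cstG g (rkOf g n) qr qs i j)⁻¹ _ _ ?_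
    rw [inv_mul_eq_smul_of_conj (genG_conj_f i j) (genG_winv_mul_w j) (inv_ne_zero (hc i j)),
      inv_inv, inv_smul_smul₀ (hc i j)]
  · exact scalar i _ _ _ (mul_eq_smul_of_conj (genG_conj_e j i) (genG_wpinv_mul_wp i))
  · exact scalar i 1 _ _ (by rw [one_smul]; exact genG_comm trivial trivial)
  · exact scalar i 1 _ _ (by rw [one_smul]; exact genG_comm trivial trivial)
  · exact scalar i _ _ _ (inv_mul_eq_smul_of_conj (genG_conj_e j i) (genG_wpinv_mul_wp i)
      (inv_ne_zero (hc i j)))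
  · exact scalar i 1 _ _ (by rw [one_smul]; exact genG_comm trivial trivial)
  · exact scalar i 1 _ _ (by rw [one_smul]; exact genG_comm trivial trivial)

end Commutation

section Isomorphism

variable {g : GT} {n : ℕ}
  {ΔB : BB g n →ₐ[KK] (BB g n ⊗[KK] BB g n)} {εB : BB g n →ₐ[KK] KK}
  {ΔB' : BB' g n →ₐ[KK] (BB' g n ⊗[KK] BB' g n)} {εB' : BB' g n →ₐ[KK] KK}
  {SB' : BB' g n →ₗ[KK] BB' g n} {p : BB' g n →ₗ[KK] BB g n →ₗ[KK] KK}
  {jB : BB g n →ₐ[KK] UG KK g n qr qs} {jB' : BB' g n →ₐ[KK] UG KK g n qr qs}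

theorem phiMap_tmul (a : BB g n) (f : BB' g n) :
    phiMap g n jB jB' (a ⊗ₜ[KK] f) = jB a * jB' f :=
  rfl

theorem phiMap_opAct_leftMulB (a : BB g n) (d : BB g n ⊗[KK] BB' g n) :
    phiMap g n jB jB' (opAct (leftMulB a) d) = jB a * phiMap g n jB jB' d := by
  induction d with
  | zero => simp only [map_zero, mul_zero]
  | add x y hx hy => simp only [map_add, mul_add, hx, hy]
  | tmul b f => rw [opAct_leftMulB, phiMap_tmul, phiMap_tmul, map_mul, mul_assoc]

namespace StdPairing

theorem rep_jB (H : StdPairing ΔB εB ΔB' εB' SB' p)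
    (hjB : ∀ x, jB (genE g n x) = genG qr qs x.toGen) (a : BB g n) :
    H.rep (jB a) = leftMulB a := by
  have : H.rep.comp jB = leftMulB := BB_hom_ext fun x => by
    rw [AlgHom.comp_apply, hjB, rep_genG, repGen_toGen]
  exact DFunLike.congr_fun this a

theorem rep_jB' (H : StdPairing ΔB εB ΔB' εB' SB' p)
    (hjB' : ∀ y, jB' (genF g n y) = genG qr qs y.toGen) (f : BB' g n) :
    H.rep (jB' f) = H.straightenB f := by
  have : H.rep.comp jB' = H.straightenB := BB'_hom_ext fun y => by
    rw [AlgHom.comp_apply, hjB', rep_genG, repGen_toGen']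
  exact DFunLike.congr_fun this f

theorem opAct_rep_phiMap_one (H : StdPairing ΔB εB ΔB' εB' SB' p)
    (hjB : ∀ x, jB (genE g n x) = genG qr qs x.toGen)
    (hjB' : ∀ y, jB' (genF g n y) = genG qr qs y.toGen) (d : BB g n ⊗[KK] BB' g n) :
    opAct (H.rep (phiMap g n jB jB' d)) (1 ⊗ₜ[KK] 1) = d := by
  induction d with
  | zero => rw [map_zero, map_zero, map_zero, LinearMap.zero_apply]
  | add x y hx hy => rw [map_add, map_add, map_add, LinearMap.add_apply, hx, hy]
  | tmul a f =>
    rw [phiMap_tmul, map_mul, opAct_mul, H.rep_jB hjB, H.rep_jB' hjB', H.opAct_straightenB_one,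
      opAct_leftMulB, mul_one, mul_one]

theorem phiMap_opAct_straightenB_gen (H : StdPairing ΔB εB ΔB' εB' SB' p)
    (hjB : ∀ x, jB (genE g n x) = genG qr qs x.toGen)
    (hjB' : ∀ y, jB' (genF g n y) = genG qr qs y.toGen) (a : BB g n) :
    ∀ (y : GenF (rkOf g n)) (f' : BB' g n),
      phiMap g n jB jB' (opAct (H.straightenB (genF g n y)) (a ⊗ₜ[KK] f')) =
        genG qr qs y.toGen * (jB a * jB' f') := by
  suffices hC : ∀ b, (∀ (y : GenF (rkOf g n)) (f' : BB' g n),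
      phiMap g n jB jB' (opAct (H.straightenB (genF g n y)) (b ⊗ₜ[KK] f')) =
        genG qr qs y.toGen * (jB b * jB' f')) → ∀ (y : GenF (rkOf g n)) (f' : BB' g n),
      phiMap g n jB jB' (opAct (H.straightenB (genF g n y)) ((a * b) ⊗ₜ[KK] f')) =
        genG qr qs y.toGen * (jB (a * b) * jB' f') by
    intro y f'
    rw [← mul_one a]
    refine hC 1 (fun y f' => ?_) y f'
    rw [H.opAct_straightenB_one, phiMap_tmul, map_mul, hjB', map_one, one_mul, one_mul]
  induction a using ringQuot_induction with
  | scalar c =>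
    intro b hb y f'
    rw [Algebra.algebraMap_eq_smul_one, smul_mul_assoc, one_mul, ← TensorProduct.smul_tmul',
      map_smul, map_smul, map_smul, hb, smul_mul_assoc, mul_smul_comm]
  | mul a₁ a₂ h₁ h₂ =>
    intro b hb
    rw [mul_assoc]
    exact h₁ _ (h₂ b hb)
  | add a₁ a₂ h₁ h₂ =>
    intro b hb y f'
    rw [add_mul, TensorProduct.add_tmul, map_add, map_add, h₁ b hb, h₂ b hb, map_add, add_mul,
      mul_add]
  | gen x =>
    intro b hb y f'
    change phiMap g n jB jB' (opAct (H.straightenB (genF g n y)) ((genE g n x * b) ⊗ₜ[KK] f')) =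
      genG qr qs y.toGen * (jB (genE g n x * b) * jB' f')
    obtain ⟨k, c, c', i, h⟩ := genG_straighten H.cstG_ne_zero y x
    have hrep : H.straightenB (genF g n y) * leftMulB (genE g n x) =
        k • (leftMulB (genE g n x) * H.straightenB (genF g n y)) +
          (c • leftMulB (genE g n (.w i)) + c' • H.straightenB (genF g n (.wp i))) := by
      have := congrArg H.rep h
      simpa only [map_mul, map_add, map_smul, rep_genG, repGen_toGen, repGen_toGen'] using this
    rw [← opAct_leftMulB, ← opAct_mul, hrep]
    simp only [map_add, map_smul, LinearMap.add_apply, LinearMap.smul_apply, opAct_mul,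
      phiMap_opAct_leftMulB, hb, phiMap_tmul, map_mul, hjB]
    rw [mul_assoc (genG qr qs x.toGen), ← mul_assoc (genG qr qs y.toGen) (genG qr qs x.toGen),
      h]
    simp only [add_mul, smul_mul_assoc, mul_assoc]

theorem phiMap_opAct_rep (H : StdPairing ΔB εB ΔB' εB' SB' p)
    (hjB : ∀ x, jB (genE g n x) = genG qr qs x.toGen)
    (hjB' : ∀ y, jB' (genF g n y) = genG qr qs y.toGen) (u : UG KK g n qr qs)
    (d : BB g n ⊗[KK] BB' g n) :
    phiMap g n jB jB' (opAct (H.rep u) d) = u * phiMap g n jB jB' d := by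
  have hE : ∀ (x : GenE (rkOf g n)) (d : BB g n ⊗[KK] BB' g n),
      phiMap g n jB jB' (opAct (H.rep (genG qr qs x.toGen)) d) =
        genG qr qs x.toGen * phiMap g n jB jB' d := fun x d => by
    rw [rep_genG, repGen_toGen, phiMap_opAct_leftMulB, hjB]
  have hF : ∀ (y : GenF (rkOf g n)) (d : BB g n ⊗[KK] BB' g n),
      phiMap g n jB jB' (opAct (H.rep (genG qr qs y.toGen)) d) =
        genG qr qs y.toGen * phiMap g n jB jB' d := fun y d => by
    rw [rep_genG, repGen_toGen']
    induction d with
    | zero => simp only [map_zero, mul_zero]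
    | add d₁ d₂ h₁ h₂ => simp only [map_add, mul_add, h₁, h₂]
    | tmul a f => exact H.phiMap_opAct_straightenB_gen hjB hjB' a y f
  induction u using ringQuot_induction generalizing d with
  | scalar c =>
    rw [AlgHom.commutes, Algebra.algebraMap_eq_smul_one, Algebra.algebraMap_eq_smul_one, map_smul,
      LinearMap.smul_apply, opAct_one, map_smul, smul_mul_assoc, one_mul]
  | mul u v hu hv => rw [map_mul, opAct_mul, hu, hv, mul_assoc]
  | add u v hu hv => rw [map_add, map_add, LinearMap.add_apply, map_add, hu, hv, add_mul]
  | gen z =>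
    rcases z with i | i | i | i | i | i
    · exact hE (.e i) d
    · exact hF (.f i) d
    · exact hE (.w i) d
    · exact hE (.winv i) d
    · exact hF (.wp i) d
    · exact hF (.wpinv i) d

theorem phiMap_bijective (H : StdPairing ΔB εB ΔB' εB' SB' p)
    (hjB : ∀ x, jB (genE g n x) = genG qr qs x.toGen)
    (hjB' : ∀ y, jB' (genF g n y) = genG qr qs y.toGen) :
    Function.Bijective (phiMap g n jB jB') := by
  refine Function.bijective_iff_has_inverse.mpr
    ⟨fun u => opAct (H.rep u) (1 ⊗ₜ[KK] 1), H.opAct_rep_phiMap_one hjB hjB', fun u => ?_⟩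
  rw [H.phiMap_opAct_rep hjB hjB', phiMap_tmul, map_one, map_one, mul_one, mul_one]

theorem phiMap_doubleMul (H : StdPairing ΔB εB ΔB' εB' SB' p)
    (hjB : ∀ x, jB (genE g n x) = genG qr qs x.toGen)
    (hjB' : ∀ y, jB' (genF g n y) = genG qr qs y.toGen) (d d' : BB g n ⊗[KK] BB' g n) :
    phiMap g n jB jB' (doubleMul g n ΔB ΔB' SB' p (d ⊗ₜ[KK] d')) =
      phiMap g n jB jB' d * phiMap g n jB jB' d' := by
  induction d with
  | zero => rw [TensorProduct.zero_tmul, map_zero, map_zero, zero_mul]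
  | add x y hx hy => rw [TensorProduct.add_tmul, map_add, map_add, map_add, hx, hy, add_mul]
  | tmul a f =>
    induction d' with
    | zero => rw [TensorProduct.tmul_zero, map_zero, map_zero, mul_zero]
    | add x y hx hy => rw [TensorProduct.tmul_add, map_add, map_add, map_add, hx, hy, mul_add]
    | tmul a' f' =>
      rw [H.doubleMul_tmul, phiMap_opAct_leftMulB, ← H.rep_jB' hjB', H.phiMap_opAct_rep hjB hjB',
        phiMap_tmul a f, mul_assoc]

end StdPairing

end Isomorphism

section Coalgebra

variable {g : GT} {n : ℕ}
  {ΔB : BB g n →ₐ[KK] (BB g n ⊗[KK] BB g n)}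
  {ΔB' : BB' g n →ₐ[KK] (BB' g n ⊗[KK] BB' g n)}
  {ΔU : UG KK g n qr qs →ₐ[KK] (UG KK g n qr qs ⊗[KK] UG KK g n qr qs)}
  {jB : BB g n →ₐ[KK] UG KK g n qr qs} {jB' : BB' g n →ₐ[KK] UG KK g n qr qs}

theorem comul_comp_eq_map_comp_B
    (h : ∀ x, ΔU (jB (genE g n x)) = Algebra.TensorProduct.map jB jB (ΔB (genE g n x)))
    (a : BB g n) : ΔU (jB a) = Algebra.TensorProduct.map jB jB (ΔB a) := by
  have : ΔU.comp jB = (Algebra.TensorProduct.map jB jB).comp ΔB := BB_hom_ext h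
  exact DFunLike.congr_fun this a

theorem comul_comp_eq_map_comp_B'
    (h : ∀ x, ΔU (jB' (genF g n x)) = Algebra.TensorProduct.map jB' jB' (ΔB' (genF g n x)))
    (f : BB' g n) : ΔU (jB' f) = Algebra.TensorProduct.map jB' jB' (ΔB' f) := by
  have : ΔU.comp jB' = (Algebra.TensorProduct.map jB' jB').comp ΔB' := BB'_hom_ext h
  exact DFunLike.congr_fun this f

theorem map_mul_map_eq_map_phiMap (s : BB g n ⊗[KK] BB g n) (t : BB' g n ⊗[KK] BB' g n) :
    Algebra.TensorProduct.map jB jB s * Algebra.TensorProduct.map jB' jB' t =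
      TensorProduct.map (phiMap g n jB jB') (phiMap g n jB jB')
        (TensorProduct.tensorTensorTensorComm KK (BB g n) (BB g n) (BB' g n) (BB' g n)
          (s ⊗ₜ[KK] t)) := by
  induction s with
  | zero => simp only [map_zero, zero_mul, TensorProduct.zero_tmul]
  | add x y hx hy => simp only [map_add, add_mul, TensorProduct.add_tmul, hx, hy]
  | tmul a a' =>
    induction t with
    | zero => simp only [map_zero, mul_zero, TensorProduct.tmul_zero]
    | add x y hx hy => simp only [map_add, mul_add, TensorProduct.tmul_add, hx, hy]
    | tmul f f' =>
      simp only [Algebra.TensorProduct.map_tmul, Algebra.TensorProduct.tmul_mul_tmul,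
        TensorProduct.tensorTensorTensorComm_tmul, TensorProduct.map_tmul, phiMap_tmul]

theorem comul_phiMap
    (hB : ∀ a, ΔU (jB a) = Algebra.TensorProduct.map jB jB (ΔB a))
    (hB' : ∀ f, ΔU (jB' f) = Algebra.TensorProduct.map jB' jB' (ΔB' f))
    (d : BB g n ⊗[KK] BB' g n) :
    ΔU (phiMap g n jB jB' d) =
      TensorProduct.map (phiMap g n jB jB') (phiMap g n jB jB') (doubleComul g n ΔB ΔB' d) := by
  induction d with
  | zero => simp only [map_zero]
  | add x y hx hy => simp only [map_add, hx, hy]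
  | tmul a f =>
    rw [phiMap_tmul, map_mul, hB, hB', map_mul_map_eq_map_phiMap]
    rfl

end Coalgebra

theorem stmt7 (g : GT) (n : ℕ)
    -- the Hopf structures of B and B'
    (ΔB : BB g n →ₐ[KK] (BB g n ⊗[KK] BB g n)) (εB : BB g n →ₐ[KK] KK)
    (ΔB' : BB' g n →ₐ[KK] (BB' g n ⊗[KK] BB' g n)) (εB' : BB' g n →ₐ[KK] KK)
    (SB' : BB' g n →ₗ[KK] BB' g n)
    (hΔB : ∀ i : Fin (rkOf g n),
      ΔB (genE g n (GenE.w i)) = genE g n (GenE.w i) ⊗ₜ[KK] genE g n (GenE.w i) ∧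
      ΔB (genE g n (GenE.winv i)) = genE g n (GenE.winv i) ⊗ₜ[KK] genE g n (GenE.winv i) ∧
      ΔB (genE g n (GenE.e i))
        = genE g n (GenE.e i) ⊗ₜ[KK] 1 + genE g n (GenE.w i) ⊗ₜ[KK] genE g n (GenE.e i))
    (hεB : ∀ i : Fin (rkOf g n), εB (genE g n (GenE.w i)) = 1 ∧
      εB (genE g n (GenE.winv i)) = 1 ∧ εB (genE g n (GenE.e i)) = 0)
    (hΔB' : ∀ i : Fin (rkOf g n),
      ΔB' (genF g n (GenF.wp i)) = genF g n (GenF.wp i) ⊗ₜ[KK] genF g n (GenF.wp i) ∧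
      ΔB' (genF g n (GenF.wpinv i)) = genF g n (GenF.wpinv i) ⊗ₜ[KK] genF g n (GenF.wpinv i) ∧
      ΔB' (genF g n (GenF.f i))
        = 1 ⊗ₜ[KK] genF g n (GenF.f i) + genF g n (GenF.f i) ⊗ₜ[KK] genF g n (GenF.wp i))
    (hεB' : ∀ i : Fin (rkOf g n), εB' (genF g n (GenF.wp i)) = 1 ∧
      εB' (genF g n (GenF.wpinv i)) = 1 ∧ εB' (genF g n (GenF.f i)) = 0)
    (hSB'1 : SB' 1 = 1) (hSB'm : ∀ x y, SB' (x * y) = SB' y * SB' x)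
    (hSB' : ∀ i : Fin (rkOf g n), SB' (genF g n (GenF.wp i)) = genF g n (GenF.wpinv i) ∧
      SB' (genF g n (GenF.wpinv i)) = genF g n (GenF.wp i) ∧
      SB' (genF g n (GenF.f i)) = -(genF g n (GenF.f i) * genF g n (GenF.wpinv i)))
    -- the skew-dual pairing
    (p : BB' g n →ₗ[KK] BB g n →ₗ[KK] KK)
    (hp : PairCondG g n ΔB εB ΔB' εB' p)
    -- the Hopf structure of U
    (ΔU : UG KK g n qr qs →ₐ[KK] (UG KK g n qr qs ⊗[KK] UG KK g n qr qs))
    (εU : UG KK g n qr qs →ₐ[KK] KK)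
    (hΔU : (∀ i : Fin (rkOf g n),
      ΔU (genG qr qs (Gen.w i)) = genG qr qs (Gen.w i) ⊗ₜ[KK] genG qr qs (Gen.w i) ∧
      ΔU (genG qr qs (Gen.winv i)) = genG qr qs (Gen.winv i) ⊗ₜ[KK] genG qr qs (Gen.winv i) ∧
      ΔU (genG qr qs (Gen.wp i)) = genG qr qs (Gen.wp i) ⊗ₜ[KK] genG qr qs (Gen.wp i) ∧
      ΔU (genG qr qs (Gen.wpinv i)) = genG qr qs (Gen.wpinv i) ⊗ₜ[KK] genG qr qs (Gen.wpinv i) ∧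
      ΔU (genG qr qs (Gen.e i))
        = genG qr qs (Gen.e i) ⊗ₜ[KK] 1 + genG qr qs (Gen.w i) ⊗ₜ[KK] genG qr qs (Gen.e i) ∧
      ΔU (genG qr qs (Gen.f i))
        = 1 ⊗ₜ[KK] genG qr qs (Gen.f i) + genG qr qs (Gen.f i) ⊗ₜ[KK] genG qr qs (Gen.wp i)))
    (hεU : ∀ i : Fin (rkOf g n),
      εU (genG qr qs (Gen.w i)) = 1 ∧ εU (genG qr qs (Gen.winv i)) = 1 ∧
      εU (genG qr qs (Gen.wp i)) = 1 ∧ εU (genG qr qs (Gen.wpinv i)) = 1 ∧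
      εU (genG qr qs (Gen.e i)) = 0 ∧ εU (genG qr qs (Gen.f i)) = 0)
    -- the canonical algebra maps of B and B' into U
    (jB : BB g n →ₐ[KK] UG KK g n qr qs) (jB' : BB' g n →ₐ[KK] UG KK g n qr qs)
    (hjB : ∀ i : Fin (rkOf g n), jB (genE g n (GenE.e i)) = genG qr qs (Gen.e i) ∧
      jB (genE g n (GenE.w i)) = genG qr qs (Gen.w i) ∧
      jB (genE g n (GenE.winv i)) = genG qr qs (Gen.winv i))
    (hjB' : ∀ i : Fin (rkOf g n), jB' (genF g n (GenF.f i)) = genG qr qs (Gen.f i) ∧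
      jB' (genF g n (GenF.wp i)) = genG qr qs (Gen.wp i) ∧
      jB' (genF g n (GenF.wpinv i)) = genG qr qs (Gen.wpinv i)) :
    -- φ is an isomorphism of Hopf algebras from the double D(B,B') onto U_{r,s}(g):
    Function.Bijective (phiMap g n jB jB') ∧
    phiMap g n jB jB' (1 ⊗ₜ[KK] 1) = 1 ∧
    (∀ d d' : BB g n ⊗[KK] BB' g n,
      phiMap g n jB jB' (doubleMul g n ΔB ΔB' SB' p (d ⊗ₜ[KK] d'))
        = phiMap g n jB jB' d * phiMap g n jB jB' d') ∧
    (∀ d : BB g n ⊗[KK] BB' g n,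
      ΔU (phiMap g n jB jB' d)
        = TensorProduct.map (phiMap g n jB jB') (phiMap g n jB jB') (doubleComul g n ΔB ΔB' d)) ∧
    (∀ d : BB g n ⊗[KK] BB' g n,
      εU (phiMap g n jB jB' d)
        = LinearMap.mul' KK KK (TensorProduct.map εB.toLinearMap εB'.toLinearMap d)) := by
  have hj : ∀ x, jB (genE g n x) = genG qr qs x.toGen := by
    rintro (i | i | i)
    · exact (hjB i).1
    · exact (hjB i).2.1
    · exact (hjB i).2.2
  have hj' : ∀ y, jB' (genF g n y) = genG qr qs y.toGen := by
    rintro (i | i | i)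
    · exact (hjB' i).1
    · exact (hjB' i).2.1
    · exact (hjB' i).2.2
  have H : StdPairing ΔB εB ΔB' εB' SB' p :=
    { comul_e := fun i => (hΔB i).2.2
      comul_toral := by
        rintro (i | i | i) hx
        · exact hx.elim
        · exact (hΔB i).1
        · exact (hΔB i).2.1
      counit_e := fun i => (hεB i).2.2
      counit_toral := by
        rintro (i | i | i) hx
        · exact hx.elim
        · exact (hεB i).1
        · exact (hεB i).2.1
      comul_f := fun i => (hΔB' i).2.2
      comul_toral' := by
        rintro (i | i | i) hx
        · exact hx.elim
        · exact (hΔB' i).1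
        · exact (hΔB' i).2.1
      counit_f := fun i => (hεB' i).2.2
      counit_toral' := by
        rintro (i | i | i) hx
        · exact hx.elim
        · exact (hεB' i).1
        · exact (hεB' i).2.1
      antipode_one := hSB'1
      antipode_mul := hSB'm
      antipode_wp := fun i => (hSB' i).1
      antipode_wpinv := fun i => (hSB' i).2.1
      antipode_f := fun i => (hSB' i).2.2
      pair := hp }
  have hB := comul_comp_eq_map_comp_B (jB := jB) (ΔB := ΔB) (ΔU := ΔU) fun x => by
    rcases x with i | i | i <;> simp only [hΔB, hj, GenE.toGen, hΔU, Algebra.TensorProduct.map_tmul,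
      map_add, map_one]
  have hB' := comul_comp_eq_map_comp_B' (jB' := jB') (ΔB' := ΔB') (ΔU := ΔU) fun x => by
    rcases x with i | i | i <;> simp only [hΔB', hj', GenF.toGen, hΔU,
      Algebra.TensorProduct.map_tmul, map_add, map_one]
  have eB : εU.comp jB = εB := BB_hom_ext fun x => by
    rcases x with i | i | i <;> simp only [AlgHom.comp_apply, hj, GenE.toGen, hεU, hεB]
  have eB' : εU.comp jB' = εB' := BB'_hom_ext fun x => by
    rcases x with i | i | i <;> simp only [AlgHom.comp_apply, hj', GenF.toGen, hεU, hεB']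
  refine ⟨H.phiMap_bijective hj hj', ?_, H.phiMap_doubleMul hj hj', fun d => ?_, fun d => ?_⟩
  · rw [phiMap_tmul, map_one, map_one, mul_one]
  · exact comul_phiMap hB hB' d
  · induction d with
    | zero => simp only [map_zero]
    | add x y hx hy => simp only [map_add, hx, hy]
    | tmul a f =>
      rw [phiMap_tmul, map_mul, ← eB, ← eB']
      rfl

end
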